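/- arXiv:1707.05008 — 6 statements merged into one kernel-verified Lean document; each statement's English description precedes it below -/
import Mathlib

section
/- Let p be a prime, ζ_p ∈ ℂ a primitive p-th root of unity, and k = (k_1,…,k_r) an index. Then z_p(k_1,…,k_r;ζ_p) lies in the ring of integers ℤ[ζ_p], and its image under the ring homomorphism ℤ[ζ_p] → ℤ[ζ_p]/(1−ζ_p) ≅ 𝔽_p (which sends ζ_p to 1) equals the finite multiple harmonic sum ∑_{p>m_1>⋯>m_r>0} ∏_{j=1}^r (m_j mod p)^{−k_j} computed in 𝔽_p. -/
/-- The `q`-integer `[m]_q = (1 - q^m)/(1 - q)`. -/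
noncomputable def qint (q : ℂ) (m : ℕ) : ℂ := (1 - q ^ m) / (1 - q)

/-- The finite multiple harmonic `q`-series
`z_n(k_1,…,k_r; q) = ∑_{n > m_1 > ⋯ > m_r > 0} ∏_j q^{(k_j-1)m_j}/[m_j]_q^{k_j}`,
defined by recursion on the index: the outermost summation variable `m₁` ranges over
`0 < m₁ < n`, and the remaining variables range below it. -/
noncomputable def zq (q : ℂ) : List ℕ → ℕ → ℂ
  | [], _ => 1
  | k :: ks, n => ∑ m ∈ Finset.Ioo 0 n, q ^ ((k - 1) * m) / qint q m ^ k * zq q ks m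

/-- The truncated multiple harmonic sum
`∑_{n > m_1 > ⋯ > m_r > 0} ∏_j (m_j mod p)^{-k_j}` in `𝔽_p = ZMod p`. -/
def mhsA (p : ℕ) : List ℕ → ℕ → ZMod p
  | [], _ => 1
  | k :: ks, n => ∑ m ∈ Finset.Ioo 0 n, ((m : ZMod p)⁻¹) ^ k * mhsA p ks m

/-- Pairs in the subring of `ℂ × ZMod p` generated by `(ζ, 1)` consist of an element of `ℤ[ζ]`
together with its image under any ring homomorphism to `ZMod p` sending `ζ` to `1`. -/
lemma exists_adjoin_of_mem_closure {p : ℕ} {ζ : ℂ} {x : ℂ × ZMod p}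
    (hx : x ∈ Subring.closure {((ζ, 1) : ℂ × ZMod p)}) :
    ∃ z : Algebra.adjoin ℤ ({ζ} : Set ℂ), (z : ℂ) = x.1 ∧
      ∀ f : Algebra.adjoin ℤ ({ζ} : Set ℂ) →+* ZMod p,
        f ⟨ζ, Algebra.subset_adjoin (Set.mem_singleton ζ)⟩ = 1 → f z = x.2 := by
  induction hx using Subring.closure_induction with
  | mem x hx =>
    rw [Set.mem_singleton_iff] at hx
    subst hx
    exact ⟨⟨ζ, Algebra.subset_adjoin (Set.mem_singleton ζ)⟩, rfl, fun f hf => hf⟩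
  | zero => exact ⟨0, rfl, fun f _ => map_zero f⟩
  | one => exact ⟨1, rfl, fun f _ => map_one f⟩
  | add x y _ _ hx hy =>
    obtain ⟨a, ha, ha'⟩ := hx
    obtain ⟨b, hb, hb'⟩ := hy
    exact ⟨a + b, by simp [ha, hb], fun f hf => by simp [ha' f hf, hb' f hf]⟩
  | neg x _ hx =>
    obtain ⟨a, ha, ha'⟩ := hx
    exact ⟨-a, by simp [ha], fun f hf => by simp [ha' f hf]⟩
  | mul x y _ _ hx hy =>
    obtain ⟨a, ha, ha'⟩ := hx
    obtain ⟨b, hb, hb'⟩ := hy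
    exact ⟨a * b, by simp [ha, hb], fun f hf => by simp [ha' f hf, hb' f hf]⟩

/-- For `0 < m < p` the inverse of the `q`-integer `[m]_ζ` is the geometric sum
`∑_{i < l} ζ^{m i}`, where `l` represents the inverse of `m` modulo `p`. -/
lemma inv_qint_eq_geom_sum {p : ℕ} [Fact p.Prime] {ζ : ℂ} (hζ : IsPrimitiveRoot ζ p) {m : ℕ}
    (hm : 0 < m) (hmp : m < p) :
    (qint ζ m)⁻¹ = ∑ i ∈ Finset.range ((m : ZMod p)⁻¹).val, (ζ ^ m) ^ i := by
  have hm0 : (m : ZMod p) ≠ 0 := fun h =>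
    Nat.not_dvd_of_pos_of_lt hm hmp ((ZMod.natCast_eq_zero_iff m p).1 h)
  have hpow : (ζ ^ m) ^ ((m : ZMod p)⁻¹).val = ζ := by
    have hmod : m * ((m : ZMod p)⁻¹).val ≡ 1 [MOD p] := by
      rw [← ZMod.natCast_eq_natCast_iff]
      simp [hm0]
    rw [← pow_mul]
    nth_rw 2 [← pow_one ζ]
    exact pow_eq_pow_of_modEq hmod hζ.pow_eq_one
  rw [geom_sum_eq (hζ.pow_ne_one_of_pos_of_lt hm.ne' hmp), hpow, qint, inv_div,
    ← neg_sub ζ 1, ← neg_sub (ζ ^ m) 1, neg_div_neg_eq]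

lemma inv_qint_mem_closure {p : ℕ} [Fact p.Prime] {ζ : ℂ} (hζ : IsPrimitiveRoot ζ p) {m : ℕ}
    (hm : 0 < m) (hmp : m < p) :
    ((qint ζ m)⁻¹, (m : ZMod p)⁻¹) ∈ Subring.closure {((ζ, 1) : ℂ × ZMod p)} := by
  have h : ((qint ζ m)⁻¹, (m : ZMod p)⁻¹) =
      ∑ i ∈ Finset.range ((m : ZMod p)⁻¹).val, (((ζ, 1) : ℂ × ZMod p) ^ m) ^ i := by
    ext
    · simp [inv_qint_eq_geom_sum hζ hm hmp, Prod.fst_sum]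
    · simp [Prod.snd_sum]
  rw [h]
  exact sum_mem fun i _ =>
    pow_mem (pow_mem (Subring.subset_closure (Set.mem_singleton _)) m) i

lemma zq_mhsA_mem_closure {p : ℕ} [Fact p.Prime] {ζ : ℂ} (hζ : IsPrimitiveRoot ζ p)
    (k : List ℕ) {n : ℕ} (hn : n ≤ p) :
    (zq ζ k n, mhsA p k n) ∈ Subring.closure {((ζ, 1) : ℂ × ZMod p)} := by
  induction k generalizing n with
  | nil => exact one_mem _
  | cons k ks ih =>
    have h : (zq ζ (k :: ks) n, mhsA p (k :: ks) n) = ∑ m ∈ Finset.Ioo 0 n,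
        ((ζ, 1) : ℂ × ZMod p) ^ ((k - 1) * m) * ((qint ζ m)⁻¹, (m : ZMod p)⁻¹) ^ k *
          (zq ζ ks m, mhsA p ks m) := by
      ext
      · simp [zq, Prod.fst_sum, div_eq_mul_inv]
      · simp [mhsA, Prod.snd_sum]
    rw [h]
    refine sum_mem fun m hm => ?_
    obtain ⟨hm0, hmn⟩ := Finset.mem_Ioo.1 hm
    exact mul_mem (mul_mem (pow_mem (Subring.subset_closure (Set.mem_singleton _)) _)
      (pow_mem (inv_qint_mem_closure hζ hm0 (hmn.trans_le hn)) k)) (ih (hmn.le.trans hn))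

/-- For a prime `p`, a primitive `p`-th root of unity `ζ ∈ ℂ` and an index `k`, the value
`z_p(k; ζ)` lies in `ℤ[ζ]`, and its image under the ring homomorphism `ℤ[ζ] → 𝔽_p`
sending `ζ` to `1` (whose kernel is the prime ideal `(1 - ζ)`) equals the truncated
multiple harmonic sum `∑_{p > m_1 > ⋯ > m_r > 0} ∏_j m_j^{-k_j}` in `𝔽_p`. -/
theorem stmt_0 (p : ℕ) (hp : p.Prime) (ζ : ℂ) (hζ : IsPrimitiveRoot ζ p)
    (k : List ℕ) (hk : ∀ i ∈ k, 0 < i) :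
    ∃ z : Algebra.adjoin ℤ ({ζ} : Set ℂ),
      (z : ℂ) = zq ζ k p ∧
      ∀ f : Algebra.adjoin ℤ ({ζ} : Set ℂ) →+* ZMod p,
        f ⟨ζ, Algebra.subset_adjoin (Set.mem_singleton ζ)⟩ = 1 →
          f z = mhsA p k p := by
  have := Fact.mk hp
  exact exists_adjoin_of_mem_closure (zq_mhsA_mem_closure hζ k le_rfl)
end

section
/- Let n ≥ 1 be an integer and ζ_n ∈ ℂ a primitive n-th root of unity. Let r ≥ 1 and let a_1,…,a_r, b_1,…,b_r be positive integers. Then z_n^⋆([a_1,…,a_r;b_1,…,b_r]; ζ_n) = (−1)^{a_1+⋯+a_r+b_1+⋯+b_r} · z_n^⋆([b_r,…,b_1;a_r,…,a_1]; ζ_n). (This is the duality z_n^⋆(k;ζ_n) = (−1)^{wt(k)+1} z_n^⋆(reverse of the Hoffman dual of k; ζ_n), since the weight of [a_1,…,a_r;b_1,…,b_r] is a_1+⋯+a_r+b_1+⋯+b_r−1 and the reverse of its Hoffman dual is [b_r,…,b_1;a_r,…,a_1].) -/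
/-- The star finite multiple harmonic `q`-series
`z_n^⋆(k_1,…,k_r; q) = ∑_{n > m_1 ≥ ⋯ ≥ m_r > 0} ∏_j q^{(k_j-1)m_j}/[m_j]_q^{k_j}`. -/
noncomputable def zqStar (q : ℂ) : List ℕ → ℕ → ℂ
  | [], _ => 1
  | k :: ks, n => ∑ m ∈ Finset.Ioo 0 n, q ^ ((k - 1) * m) / qint q m ^ k * zqStar q ks (m + 1)

/-- The index `[a_1,…,a_r; b_1,…,b_r]`, i.e.
`({1}^{a_1-1}, b_1+1, {1}^{a_2-1}, b_2+1, …, {1}^{a_{r-1}-1}, b_{r-1}+1, {1}^{a_r-1}, b_r)`. -/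
def abIndex : List ℕ → List ℕ → List ℕ
  | [a], [b] => List.replicate (a - 1) 1 ++ [b]
  | a :: as, b :: bs => List.replicate (a - 1) 1 ++ [b + 1] ++ abIndex as bs
  | _, _ => []

/-- The Gaussian binomial coefficients, defined by the `q`-Pascal rule. -/
def qChoose (q : ℂ) : ℕ → ℕ → ℂ
  | _, 0 => 1
  | 0, _ + 1 => 0
  | n + 1, m + 1 => qChoose q n m + q ^ (m + 1) * qChoose q n (m + 1)

@[simp] theorem qChoose_zero_right (q : ℂ) (n : ℕ) : qChoose q n 0 = 1 := by
  cases n <;> rfl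

theorem qChoose_succ_succ (q : ℂ) (n m : ℕ) :
    qChoose q (n + 1) (m + 1) = qChoose q n m + q ^ (m + 1) * qChoose q n (m + 1) := rfl

theorem qChoose_eq_zero_of_lt (q : ℂ) {n m : ℕ} (h : n < m) : qChoose q n m = 0 := by
  induction n generalizing m with
  | zero => cases m with
    | zero => omega
    | succ m => rfl
  | succ n ih => cases m with
    | zero => omega
    | succ m => rw [qChoose_succ_succ, ih (by omega), ih (by omega)]; ring

/-- The second `q`-Pascal rule, multiplied by `q ^ m`. -/
theorem pow_mul_qChoose_succ_succ (q : ℂ) (n m : ℕ) :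
    q ^ m * qChoose q (n + 1) (m + 1) = q ^ n * qChoose q n m + q ^ m * qChoose q n (m + 1) := by
  induction n generalizing m with
  | zero => cases m <;> simp [qChoose]
  | succ n ih => cases m with
    | zero =>
      have h := ih 0
      rw [qChoose_succ_succ q (n + 1) 0]
      simp only [qChoose_zero_right, qChoose_succ_succ q n 0] at h ⊢
      linear_combination q * h
    | succ m =>
      rw [qChoose_succ_succ q (n + 1) (m + 1)]
      have h₁ := ih m
      have h₂ := ih (m + 1)
      rw [qChoose_succ_succ q n m] at h₁ ⊢
      rw [qChoose_succ_succ q n (m + 1)] at h₂ ⊢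
      linear_combination q * h₁ + q ^ (m + 2) * h₂

theorem one_sub_pow_mul_qChoose (q : ℂ) (n m : ℕ) :
    (1 - q ^ (m + 1)) * qChoose q (n + 1) (m + 1) = (1 - q ^ (n + 1)) * qChoose q n m := by
  linear_combination qChoose_succ_succ q n m - q * pow_mul_qChoose_succ_succ q n m

theorem sum_pow_mul_qChoose (q : ℂ) (n m : ℕ) :
    ∑ j ∈ Finset.range (n + 1), q ^ (j + 1) * qChoose q j m =
      q ^ (m + 1) * qChoose q (n + 1) (m + 1) := by
  induction n with
  | zero =>
    simp only [zero_add, Finset.sum_range_one]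
    cases m <;> simp [qChoose]
  | succ n ih =>
    rw [Finset.sum_range_succ, ih]
    linear_combination -q * pow_mul_qChoose_succ_succ q (n + 1) m

/-- The sign and power of `q` occurring in the `q`-binomial transform. -/
def qSign (q : ℂ) : ℕ → ℂ
  | 0 => -1
  | m + 1 => -q ^ (m + 1) * qSign q m

theorem sum_Ico_qSign_mul_qChoose (q : ℂ) (n : ℕ) {l M : ℕ} (h : l ≤ M) :
    ∑ m ∈ Finset.Ico l M, qSign q m * qChoose q (n + 1) (m + 1) =
      qSign q l * qChoose q n l - qSign q M * qChoose q n M := by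
  induction M, h using Nat.le_induction with
  | base => simp
  | succ M h ih =>
    rw [Finset.sum_Ico_succ_top h, ih, qChoose_succ_succ, qSign]
    ring

/-- The matrix of the `q`-binomial transform. -/
def qTransform (q : ℂ) (N m : ℕ) : ℂ := q ^ (N + 1) * (qSign q m * qChoose q N m)

theorem qint_succ_ne_zero {q : ℂ} {n : ℕ} (hq : IsPrimitiveRoot q n) {m : ℕ} (h : m + 1 < n) :
    qint q (m + 1) ≠ 0 := by
  refine div_ne_zero (sub_ne_zero.2 (hq.pow_ne_one_of_pos_of_lt m.succ_ne_zero h).symm)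
    (sub_ne_zero.2 (hq.ne_one (by omega)).symm)

theorem qint_mul_qChoose (q : ℂ) (n m : ℕ) :
    qint q (m + 1) * qChoose q (n + 1) (m + 1) = qint q (n + 1) * qChoose q n m := by
  rw [qint, qint, div_mul_eq_mul_div, one_sub_pow_mul_qChoose, div_mul_eq_mul_div]

theorem sum_qTransform_div_qint {q : ℂ} {M : ℕ} (hq : IsPrimitiveRoot q (M + 1)) {N l : ℕ}
    (hN : N < M) (hl : l ≤ M) :
    ∑ m ∈ Finset.Ico l M, qTransform q N m * (1 / qint q (m + 1)) =
      1 / qint q (N + 1) * qTransform q N l := by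
  have hN' := qint_succ_ne_zero hq (Nat.succ_lt_succ hN)
  have key : ∀ m ∈ Finset.Ico l M, qTransform q N m * (1 / qint q (m + 1)) =
      q ^ (N + 1) / qint q (N + 1) * (qSign q m * qChoose q (N + 1) (m + 1)) := by
    intro m hm
    have hm' := qint_succ_ne_zero hq (Nat.succ_lt_succ (Finset.mem_Ico.1 hm).2)
    rw [qTransform]
    field_simp
    linear_combination -q ^ (N + 1) * qSign q m * qint_mul_qChoose q N m
  rw [Finset.sum_congr rfl key, ← Finset.mul_sum, sum_Ico_qSign_mul_qChoose q N hl,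
    qChoose_eq_zero_of_lt q hN, qTransform]
  ring

theorem sum_qTransform_left {q : ℂ} {M : ℕ} (hq : IsPrimitiveRoot q (M + 1)) {N m : ℕ}
    (hN : N < M) (hm : m < M) :
    q ^ (N + 1) / qint q (N + 1) * ∑ j ∈ Finset.range (N + 1), qTransform q j m =
      q ^ (m + 1) / qint q (m + 1) * qTransform q N m := by
  have hN' := qint_succ_ne_zero hq (Nat.succ_lt_succ hN)
  have hm' := qint_succ_ne_zero hq (Nat.succ_lt_succ hm)
  have key : ∑ j ∈ Finset.range (N + 1), qTransform q j m =
      qSign q m * (q ^ (m + 1) * qChoose q (N + 1) (m + 1)) := by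
    rw [← sum_pow_mul_qChoose, Finset.mul_sum]
    exact Finset.sum_congr rfl fun j _ => by rw [qTransform]; ring
  rw [key, qTransform]
  field_simp
  linear_combination q ^ (N + 1) * q ^ (m + 1) * qSign q m * qint_mul_qChoose q N m

theorem qSign_mul_qChoose {q : ℂ} {M : ℕ} (hq : IsPrimitiveRoot q (M + 1)) {m : ℕ} (hm : m ≤ M) :
    qSign q m * qChoose q M m = -1 := by
  induction m with
  | zero => simp [qSign]
  | succ m ih =>
    have h := one_sub_pow_mul_qChoose q M m
    rw [hq.pow_eq_one, sub_self, zero_mul] at h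
    have h0 := (mul_eq_zero.1 h).resolve_left
      (sub_ne_zero.2 (hq.pow_ne_one_of_pos_of_lt m.succ_ne_zero (Nat.succ_lt_succ hm)).symm)
    rw [qChoose_succ_succ] at h0
    rw [qSign]
    linear_combination ih (by omega) - qSign q m * h0

theorem sum_qTransform_eq_one {q : ℂ} {M : ℕ} (hq : IsPrimitiveRoot q (M + 1)) {m : ℕ}
    (hm : m < M) : ∑ N ∈ Finset.range M, qTransform q N m = 1 := by
  obtain ⟨K, rfl⟩ : ∃ K, M = K + 1 := ⟨M - 1, by omega⟩
  have key : ∑ N ∈ Finset.range (K + 1), qTransform q N m =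
      qSign q m * (q ^ (m + 1) * qChoose q (K + 1) (m + 1)) := by
    rw [← sum_pow_mul_qChoose, Finset.mul_sum]
    exact Finset.sum_congr rfl fun j _ => by rw [qTransform]; ring
  have h := qSign_mul_qChoose hq (Nat.succ_le_of_lt hm)
  rw [qSign] at h
  rw [key]
  linear_combination -h

/-- The operator attached to a letter: `true` multiplies by `d`, `false` sums over `S` and
multiplies by `e`. -/
def letterOp (d e : ℕ → ℂ) (S : ℕ → Finset ℕ) : Bool → (ℕ → ℂ) → ℕ → ℂ
  | true, f => fun m => d m * f m
  | false, f => fun m => e m * ∑ l ∈ S m, f l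

/-- The iterated sum attached to a word, with innermost function `f`. -/
def wordOp (d e : ℕ → ℂ) (S : ℕ → Finset ℕ) (f : ℕ → ℂ) (w : List Bool) : ℕ → ℂ :=
  w.foldr (letterOp d e S) f

/-- Iterated sums with weakly decreasing variables. -/
def lowerSum (d e : ℕ → ℂ) (w : List Bool) : ℕ → ℂ :=
  wordOp d e (fun m => Finset.Ioo 0 (m + 1)) e w

theorem lowerSum_replicate_true_append (d e : ℕ → ℂ) (w : List Bool) (j m : ℕ) :
    lowerSum d e (List.replicate j true ++ w) m = d m ^ j * lowerSum d e w m := by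
  induction j with
  | zero => simp
  | succ j ih =>
    rw [List.replicate_succ, List.cons_append]
    change d m * lowerSum d e (List.replicate j true ++ w) m = _
    rw [ih]; ring

theorem sum_Ioo_zero_succ (f : ℕ → ℂ) (M : ℕ) :
    ∑ m ∈ Finset.Ioo 0 (M + 1), f m = ∑ m ∈ Finset.range M, f (m + 1) := by
  rw [Finset.range_eq_Ico, Finset.sum_Ico_add' f 0 M 1]
  rfl

/-- The `q`-binomial transform exchanges the two letters. -/
theorem sum_qTransform_mul_lowerSum {q : ℂ} {M : ℕ} (hq : IsPrimitiveRoot q (M + 1))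
    (w : List Bool) {N : ℕ} (hN : N < M) :
    ∑ m ∈ Finset.range M, qTransform q N m *
        lowerSum (fun m => q ^ m / qint q m) (fun m => 1 / qint q m) w (m + 1) =
      -lowerSum (fun m => 1 / qint q m) (fun m => q ^ m / qint q m) (w.map not) (N + 1) := by
  induction w generalizing N with
  | nil =>
    have h := sum_qTransform_div_qint hq hN M.zero_le
    rw [← Finset.range_eq_Ico] at h
    refine h.trans ?_
    simp only [qTransform, qSign, qChoose_zero_right]
    change _ = -(q ^ (N + 1) / qint q (N + 1))
    ring
  | cons x w ih =>
    set F := lowerSum (fun m => q ^ m / qint q m) (fun m => 1 / qint q m) w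
    set G := lowerSum (fun m => 1 / qint q m) (fun m => q ^ m / qint q m) (w.map not)
    cases x with
    | true =>
      change ∑ m ∈ Finset.range M, qTransform q N m *
        (q ^ (m + 1) / qint q (m + 1) * F (m + 1)) =
        -(q ^ (N + 1) / qint q (N + 1) * ∑ l ∈ Finset.Ioo 0 (N + 1 + 1), G l)
      rw [sum_Ioo_zero_succ, ← mul_neg, ← Finset.sum_neg_distrib,
        Finset.sum_congr rfl fun j hj => (ih (N := j) (by
          have := Finset.mem_range.1 hj; omega)).symm, Finset.sum_comm, Finset.mul_sum]
      refine Finset.sum_congr rfl fun m hm => ?_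
      rw [← Finset.sum_mul, ← mul_assoc (_ / _), sum_qTransform_left hq hN (Finset.mem_range.1 hm)]
      ring
    | false =>
      change ∑ m ∈ Finset.range M, qTransform q N m *
        (1 / qint q (m + 1) * ∑ l ∈ Finset.Ioo 0 (m + 1 + 1), F l) =
        -(1 / qint q (N + 1) * G (N + 1))
      rw [← mul_neg, ← ih hN, Finset.mul_sum]
      simp only [sum_Ioo_zero_succ, Finset.mul_sum]
      rw [Finset.sum_comm' (t' := Finset.range M) (s' := fun l => Finset.Ico l M)
        (by intro m l; simp only [Finset.mem_range, Finset.mem_Ico]; omega)]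
      refine Finset.sum_congr rfl fun l hl => ?_
      rw [← mul_assoc, ← sum_qTransform_div_qint hq hN (Finset.mem_range.1 hl).le, Finset.sum_mul]
      exact Finset.sum_congr rfl fun m _ => by ring

theorem sum_lowerSum_eq_neg {q : ℂ} {M : ℕ} (hq : IsPrimitiveRoot q (M + 1)) (w : List Bool) :
    ∑ m ∈ Finset.Ioo 0 (M + 1), lowerSum (fun m => q ^ m / qint q m) (fun m => 1 / qint q m) w m =
      -∑ m ∈ Finset.Ioo 0 (M + 1),
        lowerSum (fun m => 1 / qint q m) (fun m => q ^ m / qint q m) (w.map not) m := by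
  rw [sum_Ioo_zero_succ, sum_Ioo_zero_succ, ← Finset.sum_neg_distrib,
    Finset.sum_congr rfl fun N hN =>
      (sum_qTransform_mul_lowerSum hq w (Finset.mem_range.1 hN)).symm, Finset.sum_comm]
  refine Finset.sum_congr rfl fun m hm => ?_
  rw [← Finset.sum_mul, sum_qTransform_eq_one hq (Finset.mem_range.1 hm), one_mul]

theorem sum_Ioo_zero_reflect (f : ℕ → ℂ) (n : ℕ) :
    ∑ m ∈ Finset.Ioo 0 n, f m = ∑ m ∈ Finset.Ioo 0 n, f (n - m) := by
  refine Finset.sum_nbij' (fun m => n - m) (fun m => n - m) ?_ ?_ ?_ ?_ ?_ <;>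
    simp only [Finset.mem_Ioo] <;> intro m hm
  · omega
  · omega
  · omega
  · omega
  · rw [Nat.sub_sub_self hm.2.le]

theorem qint_sub {q : ℂ} {n : ℕ} (hq : IsPrimitiveRoot q n) {m : ℕ} (hm : m ≤ n) :
    q ^ m * qint q (n - m) = -qint q m := by
  have h : q ^ m * q ^ (n - m) = 1 := by rw [← pow_add, Nat.add_sub_cancel' hm, hq.pow_eq_one]
  rw [qint, qint, ← mul_div_assoc, ← neg_div]
  congr 1
  linear_combination -h

/-- The substitution `m ↦ n - m` turns weakly decreasing variables into weakly increasing ones. -/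
theorem lowerSum_reflect {q : ℂ} {n : ℕ} (hq : IsPrimitiveRoot q n) (hn : 0 < n) (w : List Bool)
    {m : ℕ} (hm0 : 0 < m) (hm : m < n) :
    lowerSum (fun m => 1 / qint q m) (fun m => q ^ m / qint q m) w (n - m) =
      (-1) ^ (w.length + 1) * wordOp (fun m => q ^ m / qint q m) (fun m => 1 / qint q m)
        (fun m => Finset.Ico m n) (fun m => 1 / qint q m) w m := by
  have hq0 : q ≠ 0 := hq.ne_zero hn.ne'
  have hd : ∀ {m : ℕ}, m < n → 1 / qint q (n - m) = -(q ^ m / qint q m) := fun {m} hm => by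
    have h := qint_sub hq hm.le
    rw [← neg_eq_iff_eq_neg.2 h, div_neg, neg_neg, ← div_div, div_self (pow_ne_zero _ hq0)]
  have he : ∀ {m : ℕ}, m < n → q ^ (n - m) / qint q (n - m) = -(1 / qint q m) := fun {m} hm => by
    have h : q ^ m * q ^ (n - m) = 1 := by
      rw [← pow_add, Nat.add_sub_cancel' hm.le, hq.pow_eq_one]
    rw [div_eq_mul_one_div, hd hm]
    linear_combination -h / qint q m
  induction w generalizing m with
  | nil =>
    change q ^ (n - m) / qint q (n - m) = (-1) ^ (0 + 1) * (1 / qint q m)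
    rw [he hm]; ring
  | cons x w ih =>
    set G := lowerSum (fun m => 1 / qint q m) (fun m => q ^ m / qint q m) w
    set U := wordOp (fun m => q ^ m / qint q m) (fun m => 1 / qint q m)
        (fun m => Finset.Ico m n) (fun m => 1 / qint q m) w
    rw [List.length_cons]
    cases x with
    | true =>
      change 1 / qint q (n - m) * G (n - m) = (-1) ^ (w.length + 1 + 1) * (q ^ m / qint q m * U m)
      rw [ih hm0 hm, hd hm]; ring
    | false =>
      change q ^ (n - m) / qint q (n - m) * ∑ l ∈ Finset.Ioo 0 (n - m + 1), G l =
        (-1) ^ (w.length + 1 + 1) * (1 / qint q m * ∑ l ∈ Finset.Ico m n, U l)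
      have key : ∑ l ∈ Finset.Ioo 0 (n - m + 1), G l =
          ∑ l ∈ Finset.Ico m n, (-1) ^ (w.length + 1) * U l := by
        refine Finset.sum_nbij' (fun l => n - l) (fun l => n - l) ?_ ?_ ?_ ?_ ?_ <;>
          simp only [Finset.mem_Ioo, Finset.mem_Ico] <;> intro l hl
        · omega
        · omega
        · omega
        · omega
        · rw [← ih (m := n - l) (by omega) (by omega), Nat.sub_sub_self (by omega)]
      rw [key, he hm, ← Finset.mul_sum]; ring

/-- Exchanging the order of summation reverses the word. -/
theorem sum_mul_lowerSum (d e h : ℕ → ℂ) (n : ℕ) (w : List Bool) :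
    ∑ m ∈ Finset.Ioo 0 n, h m * lowerSum d e w m =
      ∑ m ∈ Finset.Ioo 0 n,
        wordOp d e (fun m => Finset.Ico m n) (fun m => e m * h m) w.reverse m := by
  induction w generalizing h with
  | nil => exact Finset.sum_congr rfl fun m _ => mul_comm _ _
  | cons x w ih =>
    rw [List.reverse_cons]
    cases x with
    | true =>
      have hU : ∀ m, wordOp d e (fun m => Finset.Ico m n) (fun m => e m * h m)
          (w.reverse ++ [true]) m = wordOp d e (fun m => Finset.Ico m n)
          (fun m => e m * (h m * d m)) w.reverse m := fun m => by
        simp only [wordOp, List.foldr_append, List.foldr_cons, List.foldr_nil, letterOp,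
          mul_left_comm, mul_comm (h _)]
      simp only [hU]
      rw [← ih]
      refine Finset.sum_congr rfl fun m _ => ?_
      change h m * (d m * lowerSum d e w m) = _
      ring
    | false =>
      have hU : ∀ m, wordOp d e (fun m => Finset.Ico m n) (fun m => e m * h m)
          (w.reverse ++ [false]) m = wordOp d e (fun m => Finset.Ico m n)
          (fun m => e m * ∑ l ∈ Finset.Ico m n, e l * h l) w.reverse m := fun m => by
        simp only [wordOp, List.foldr_append, List.foldr_cons, List.foldr_nil, letterOp]
      simp only [hU]
      rw [← ih]
      change ∑ m ∈ Finset.Ioo 0 n, h m * (e m * ∑ l ∈ Finset.Ioo 0 (m + 1), lowerSum d e w l) = _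
      simp only [Finset.mul_sum, Finset.sum_mul]
      rw [Finset.sum_comm' (t' := Finset.Ioo 0 n) (s' := fun l => Finset.Ico l n)
        (by intro m l; simp only [Finset.mem_Ioo, Finset.mem_Ico]; omega)]
      exact Finset.sum_congr rfl fun l _ => Finset.sum_congr rfl fun m _ => by ring

theorem sum_lowerSum_duality {q : ℂ} {n : ℕ} (hn : 0 < n) (hq : IsPrimitiveRoot q n)
    (w : List Bool) :
    ∑ m ∈ Finset.Ioo 0 n, lowerSum (fun m => q ^ m / qint q m) (fun m => 1 / qint q m) w m =
      (-1) ^ w.length * ∑ m ∈ Finset.Ioo 0 n,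
        lowerSum (fun m => q ^ m / qint q m) (fun m => 1 / qint q m) (w.map not).reverse m := by
  obtain ⟨M, rfl⟩ : ∃ M, n = M + 1 := ⟨n - 1, by omega⟩
  have h := sum_mul_lowerSum (fun m => q ^ m / qint q m) (fun m => 1 / qint q m) (fun _ => 1)
    (M + 1) (w.map not).reverse
  simp only [one_mul, mul_one, List.reverse_reverse] at h
  rw [sum_lowerSum_eq_neg hq, sum_Ioo_zero_reflect, h, Finset.mul_sum, ← Finset.sum_neg_distrib]
  refine Finset.sum_congr rfl fun m hm => ?_
  rw [Finset.mem_Ioo] at hm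
  rw [lowerSum_reflect hq hn _ hm.1 hm.2, List.length_map]
  ring

/-- The word of an index: each entry `k` contributes `false` followed by `k - 1` times `true`. -/
def indexWord (k : List ℕ) : List Bool :=
  k.flatMap fun j => false :: List.replicate (j - 1) true

theorem zqStar_cons_eq_sum (q : ℂ) {k : ℕ} (hk : 0 < k) {ks : List ℕ} (hks : ∀ i ∈ ks, 0 < i)
    (n : ℕ) :
    zqStar q (k :: ks) n = ∑ m ∈ Finset.Ioo 0 n,
      lowerSum (fun m => q ^ m / qint q m) (fun m => 1 / qint q m)
        (List.replicate (k - 1) true ++ indexWord ks) m := by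
  induction ks generalizing k n with
  | nil =>
    rw [zqStar]
    refine Finset.sum_congr rfl fun m _ => ?_
    obtain ⟨j, rfl⟩ : ∃ j, k = j + 1 := ⟨k - 1, by omega⟩
    rw [lowerSum_replicate_true_append]
    change _ = (q ^ m / qint q m) ^ (j + 1 - 1) * (1 / qint q m)
    rw [zqStar, Nat.add_sub_cancel, mul_comm j m, pow_mul, div_pow, pow_succ, ← div_div]
    ring
  | cons k' ks ih =>
    rw [zqStar]
    refine Finset.sum_congr rfl fun m _ => ?_
    obtain ⟨j, rfl⟩ : ∃ j, k = j + 1 := ⟨k - 1, by omega⟩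
    rw [ih (hks k' (by simp)) fun i hi => hks i (by simp [hi]), lowerSum_replicate_true_append]
    change _ = (q ^ m / qint q m) ^ (j + 1 - 1) * (1 / qint q m * ∑ l ∈ Finset.Ioo 0 (m + 1),
      lowerSum _ _ (List.replicate (k' - 1) true ++ indexWord ks) l)
    rw [Nat.add_sub_cancel, mul_comm j m, pow_mul, div_pow, pow_succ, ← div_div]
    ring

theorem zqStar_eq_sum_of_indexWord (q : ℂ) {k : List ℕ} (hk : ∀ i ∈ k, 0 < i) {w : List Bool}
    (hw : indexWord k = false :: w) (n : ℕ) :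
    zqStar q k n = ∑ m ∈ Finset.Ioo 0 n,
      lowerSum (fun m => q ^ m / qint q m) (fun m => 1 / qint q m) w m := by
  cases k with
  | nil => simp [indexWord] at hw
  | cons k ks =>
    obtain rfl : List.replicate (k - 1) true ++ indexWord ks = w := by
      simpa [indexWord] using hw
    exact zqStar_cons_eq_sum q (hk k (by simp)) (fun i hi => hk i (by simp [hi])) n

/-- The word `false^{a_1} true^{b_1} ⋯ false^{a_r} true^{b_r}`. -/
def blockWord (a b : List ℕ) : List Bool :=
  (List.zipWith (fun i j => List.replicate i false ++ List.replicate j true) a b).flatten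

theorem indexWord_append (k l : List ℕ) : indexWord (k ++ l) = indexWord k ++ indexWord l :=
  List.flatMap_append

theorem indexWord_replicate_one (j : ℕ) :
    indexWord (List.replicate j 1) = List.replicate j false := by
  induction j with
  | zero => rfl
  | succ j ih =>
    rw [List.replicate_succ, List.replicate_succ, ← ih]
    rfl

theorem indexWord_replicate_append_singleton {i : ℕ} (hi : 0 < i) (j : ℕ) :
    indexWord (List.replicate (i - 1) 1 ++ [j]) =
      List.replicate i false ++ List.replicate (j - 1) true := by
  obtain ⟨i, rfl⟩ : ∃ s, i = s + 1 := ⟨i - 1, by omega⟩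
  rw [indexWord_append, indexWord_replicate_one, List.replicate_succ']
  simp [indexWord]

theorem indexWord_abIndex {a b : List ℕ} (ha : a ≠ []) (hlen : a.length = b.length)
    (hapos : ∀ i ∈ a, 0 < i) (hbpos : ∀ i ∈ b, 0 < i) :
    indexWord (abIndex a b) ++ [true] = blockWord a b := by
  induction a generalizing b with
  | nil => exact absurd rfl ha
  | cons i a ih =>
    obtain _ | ⟨j, b⟩ := b
    · simp at hlen
    have hi : 0 < i := hapos i (by simp)
    have hj : 0 < j := hbpos j (by simp)
    obtain _ | ⟨i', a⟩ := a
    · obtain rfl : b = [] := by simpa using hlen.symm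
      obtain ⟨j, rfl⟩ : ∃ s, j = s + 1 := ⟨j - 1, by omega⟩
      rw [abIndex, indexWord_replicate_append_singleton hi, Nat.add_sub_cancel]
      simp [blockWord, List.replicate_succ']
    · obtain _ | ⟨j', b⟩ := b
      · simp at hlen
      rw [abIndex, indexWord_append, indexWord_replicate_append_singleton hi, List.append_assoc,
        ih (by simp) (by simpa using hlen) (fun s hs => hapos s (List.mem_cons_of_mem _ hs))
          (fun s hs => hbpos s (List.mem_cons_of_mem _ hs)), Nat.add_sub_cancel]
      · rfl
      · simp

theorem abIndex_pos {a b : List ℕ} (hbpos : ∀ i ∈ b, 0 < i) : ∀ i ∈ abIndex a b, 0 < i := by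
  fun_induction abIndex a b with
  | case1 a b =>
    intro i hi
    rcases List.mem_append.1 hi with hi | hi
    · rw [List.eq_of_mem_replicate hi]; exact Nat.one_pos
    · exact hbpos i hi
  | case2 a as b bs _ ih =>
    intro i hi
    rcases List.mem_append.1 hi with hi | hi
    · rcases List.mem_append.1 hi with hi | hi
      · rw [List.eq_of_mem_replicate hi]; exact Nat.one_pos
      · rw [List.mem_singleton.1 hi]; exact Nat.succ_pos _
    · exact ih (fun s hs => hbpos s (List.mem_cons_of_mem _ hs)) i hi
  | case3 => simp

theorem blockWord_reverse {a b : List ℕ} (hlen : a.length = b.length) :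
    blockWord b.reverse a.reverse = ((blockWord a b).map not).reverse := by
  rw [blockWord, blockWord, List.map_flatten, List.reverse_flatten, List.map_map,
    ← List.reverse_zipWith hlen.symm, List.map_zipWith, List.zipWith_comm]
  simp

theorem length_blockWord {a b : List ℕ} (hlen : a.length = b.length) :
    (blockWord a b).length = a.sum + b.sum := by
  induction a generalizing b with
  | nil =>
    obtain rfl : b = [] := by simpa using hlen.symm
    rfl
  | cons i a ih =>
    obtain _ | ⟨j, b⟩ := b
    · simp at hlen
    have h := ih (b := b) (by simpa using hlen)
    simp only [blockWord, List.zipWith_cons_cons, List.flatten_cons, List.length_append,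
      List.length_replicate, List.sum_cons] at h ⊢
    omega

theorem exists_indexWord_abIndex {a b : List ℕ} (ha : a ≠ []) (hlen : a.length = b.length)
    (hapos : ∀ i ∈ a, 0 < i) (hbpos : ∀ i ∈ b, 0 < i) :
    ∃ w, indexWord (abIndex a b) = false :: w := by
  have h := indexWord_abIndex ha hlen hapos hbpos
  obtain _ | ⟨i, a⟩ := a
  · exact absurd rfl ha
  obtain _ | ⟨j, b⟩ := b
  · simp at hlen
  obtain ⟨i, rfl⟩ : ∃ s, i = s + 1 := ⟨i - 1, by have := hapos i (by simp); omega⟩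
  obtain ⟨j, rfl⟩ : ∃ s, j = s + 1 := ⟨j - 1, by have := hbpos j (by simp); omega⟩
  cases hk : indexWord (abIndex ((i + 1) :: a) ((j + 1) :: b)) with
  | nil => simp [hk, blockWord, List.replicate_succ] at h
  | cons x w =>
    rw [hk] at h
    simp only [blockWord, List.zipWith_cons_cons, List.flatten_cons, List.replicate_succ,
      List.cons_append, List.cons.injEq] at h
    exact ⟨w, by rw [h.1]⟩

/-- Duality: for any `n ≥ 1`, any primitive `n`-th root of unity `ζ_n` and any positive
integers `a_1,…,a_r, b_1,…,b_r` (`r ≥ 1`),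
`z_n^⋆([a_1,…,a_r;b_1,…,b_r]; ζ_n)
  = (-1)^{a_1+⋯+a_r+b_1+⋯+b_r} z_n^⋆([b_r,…,b_1;a_r,…,a_1]; ζ_n)`. -/
theorem stmt_2 (n : ℕ) (hn : 1 ≤ n) (ζ : ℂ) (hζ : IsPrimitiveRoot ζ n)
    (a b : List ℕ) (ha : a ≠ []) (hlen : a.length = b.length)
    (hapos : ∀ i ∈ a, 0 < i) (hbpos : ∀ i ∈ b, 0 < i) :
    zqStar ζ (abIndex a b) n =
      (-1 : ℂ) ^ (a.sum + b.sum) * zqStar ζ (abIndex b.reverse a.reverse) n := by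
  obtain ⟨w, hw⟩ := exists_indexWord_abIndex ha hlen hapos hbpos
  have hlen' : b.reverse.length = a.reverse.length := by simp [hlen]
  have hb : b.reverse ≠ [] := by
    rw [← List.length_pos_iff, hlen', List.length_reverse]
    exact List.length_pos_iff.2 ha
  have hapos' : ∀ i ∈ a.reverse, 0 < i := fun i hi => hapos i (List.mem_reverse.1 hi)
  have hbpos' : ∀ i ∈ b.reverse, 0 < i := fun i hi => hbpos i (List.mem_reverse.1 hi)
  obtain ⟨w', hw'⟩ := exists_indexWord_abIndex hb hlen' hbpos' hapos'
  have h := indexWord_abIndex ha hlen hapos hbpos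
  have h' := indexWord_abIndex hb hlen' hbpos' hapos'
  have hwlen := length_blockWord hlen
  rw [blockWord_reverse hlen, ← h, hw, hw'] at h'
  rw [← h, hw] at hwlen
  obtain rfl : w' = (w.map not).reverse := by simpa using h'
  rw [zqStar_eq_sum_of_indexWord ζ (abIndex_pos hbpos) hw,
    zqStar_eq_sum_of_indexWord ζ (abIndex_pos hapos') hw', sum_lowerSum_duality hn hζ w, ← hwlen]
  congr 1
  simp [pow_succ]
end

section
/- For every index k = (k_1,…,k_r), the limit ξ^⋆(k) := lim_{n→∞} z_n^⋆(k; e^{2πi/n}) equals the sum, over all 2^{r−1} ways of replacing each of the r−1 separating commas in (k_1,…,k_r) by either a comma or a plus sign, of ξ(k_1 □ ⋯ □ k_r), where ξ(l) := lim_{n→∞} z_n(l; e^{2πi/n}) (all these limits exist). Equivalently, ξ^⋆(k_1,…,k_r) = ∑_{(l_1,…,l_s)} ξ(l_1,…,l_s), the sum being over all indices obtained from (k_1,…,k_r) by summing consecutive blocks of entries. -/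
open Filter

/-- The list of the `2^{r-1}` indices obtained from `(k_1,…,k_r)` by replacing each
separating comma by a comma or a plus sign, i.e. by summing consecutive blocks of
entries. -/
def contractions : List ℕ → List (List ℕ)
  | [] => [[]]
  | [k] => [[k]]
  | k :: ks =>
      ((contractions ks).map (k :: ·)) ++
        ((contractions ks).map (fun l => (k + l.headI) :: l.tail))

open Topology Finset

/-- The primitive root of unity `e^{2πi/n}`. -/
noncomputable def unitRoot (n : ℕ) : ℂ := Complex.exp (2 * Real.pi * Complex.I / n)

/-- A doubly indexed family whose entries `v n m` converge as `n → ∞` and are of size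
`m^{-s}` up to powers of `1 + log m`, uniformly for `0 < m ≤ n / 2`. -/
def HalfTame (s : ℕ) (v : ℕ → ℕ → ℂ) : Prop :=
  (∃ C : ℝ, 0 ≤ C ∧ ∃ p : ℕ, ∀ n m : ℕ, 0 < m → 2 * m ≤ n →
    ‖v n m‖ ≤ C * (1 + Real.log m) ^ p / (m : ℝ) ^ s) ∧
  ∀ m : ℕ, 0 < m → ∃ a, Tendsto (fun n => v n m) atTop (𝓝 a)

/-- A family which is `HalfTame` at both ends of the range `0 < m < n`. -/
def Tame (s : ℕ) (v : ℕ → ℕ → ℂ) : Prop :=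
  HalfTame s v ∧ HalfTame s fun n m => v n (n - m)

lemma one_le_one_add_log (m : ℕ) : 1 ≤ 1 + Real.log m := by
  have := Real.log_natCast_nonneg m
  linarith

namespace HalfTame

variable {s t : ℕ} {v w : ℕ → ℕ → ℂ}

lemma congr (hv : HalfTame s v) (h : ∀ n m, 0 < m → 2 * m ≤ n → v n m = w n m) :
    HalfTame s w := by
  obtain ⟨⟨C, hC, p, hb⟩, hl⟩ := hv
  refine ⟨⟨C, hC, p, fun n m hm hn => h n m hm hn ▸ hb n m hm hn⟩, fun m hm => ?_⟩
  obtain ⟨a, ha⟩ := hl m hm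
  refine ⟨a, ha.congr' ?_⟩
  filter_upwards [eventually_ge_atTop (2 * m)] with n hn using h n m hm hn

lemma mul (hv : HalfTame s v) (hw : HalfTame t w) :
    HalfTame (s + t) fun n m => v n m * w n m := by
  obtain ⟨⟨C, hC, p, hb⟩, hl⟩ := hv
  obtain ⟨⟨D, hD, r, hd⟩, hk⟩ := hw
  refine ⟨⟨C * D, mul_nonneg hC hD, p + r, fun n m hm hn => ?_⟩, fun m hm => ?_⟩
  · rw [norm_mul]
    refine (mul_le_mul (hb n m hm hn) (hd n m hm hn) (norm_nonneg _) ?_).trans_eq ?_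
    · have := one_le_one_add_log m
      positivity
    · rw [pow_add, pow_add, div_mul_div_comm]
      ring
  · obtain ⟨a, ha⟩ := hl m hm
    obtain ⟨b, hb⟩ := hk m hm
    exact ⟨_, ha.mul hb⟩

lemma add (hv : HalfTame s v) (hw : HalfTame s w) :
    HalfTame s fun n m => v n m + w n m := by
  obtain ⟨⟨C, hC, p, hb⟩, hl⟩ := hv
  obtain ⟨⟨D, hD, r, hd⟩, hk⟩ := hw
  refine ⟨⟨C + D, add_nonneg hC hD, p + r, fun n m hm hn => ?_⟩, fun m hm => ?_⟩
  · have hL := one_le_one_add_log m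
    have h₁ := pow_le_pow_right₀ hL (Nat.le_add_right p r)
    have h₂ := pow_le_pow_right₀ hL (Nat.le_add_left r p)
    calc ‖v n m + w n m‖ ≤ ‖v n m‖ + ‖w n m‖ := norm_add_le _ _
      _ ≤ C * (1 + Real.log m) ^ p / (m : ℝ) ^ s
          + D * (1 + Real.log m) ^ r / (m : ℝ) ^ s := add_le_add (hb n m hm hn) (hd n m hm hn)
      _ ≤ C * (1 + Real.log m) ^ (p + r) / (m : ℝ) ^ s
          + D * (1 + Real.log m) ^ (p + r) / (m : ℝ) ^ s := by gcongr
      _ = _ := by ring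
  · obtain ⟨a, ha⟩ := hl m hm
    obtain ⟨b, hb⟩ := hk m hm
    exact ⟨_, ha.add hb⟩

lemma mono (hv : HalfTame s v) (hts : t ≤ s) : HalfTame t v := by
  obtain ⟨⟨C, hC, p, hb⟩, hl⟩ := hv
  refine ⟨⟨C, hC, p, fun n m hm hn => (hb n m hm hn).trans ?_⟩, hl⟩
  have hL := one_le_one_add_log m
  have hm' : (1 : ℝ) ≤ m := by exact_mod_cast hm
  gcongr

lemma of_tendsto {c : ℕ → ℂ} {a : ℂ} (hc : Tendsto c atTop (𝓝 a)) :
    HalfTame 0 fun n _ => c n := by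
  obtain ⟨C, hC⟩ := (Metric.isBounded_range_of_tendsto c hc).exists_norm_le
  have h (n : ℕ) : ‖c n‖ ≤ C := hC _ ⟨n, rfl⟩
  exact ⟨⟨C, (norm_nonneg _).trans (h 0), 0, fun n m _ _ => by simpa using h n⟩,
    fun _ _ => ⟨a, hc⟩⟩

lemma neg (hv : HalfTame s v) : HalfTame s fun n m => -v n m := by
  refine ((of_tendsto (tendsto_const_nhds (x := (-1 : ℂ)))).mul hv).mono (by omega) |>.congr ?_
  intros
  ring

lemma sum_Ioc (hv : HalfTame 1 v) : HalfTame 0 fun n m => ∑ i ∈ Ioc 0 m, v n i := by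
  obtain ⟨⟨C, hC, p, hb⟩, hl⟩ := hv
  refine ⟨⟨C, hC, p + 1, fun n m hm hn => ?_⟩, fun m hm => ?_⟩
  · have hL := one_le_one_add_log m
    calc ‖∑ i ∈ Ioc 0 m, v n i‖ ≤ ∑ i ∈ Ioc 0 m, ‖v n i‖ := norm_sum_le _ _
      _ ≤ ∑ i ∈ Ioc 0 m, C * (1 + Real.log m) ^ p * (i : ℝ)⁻¹ := by
        refine sum_le_sum fun i hi => ?_
        rw [mem_Ioc] at hi
        refine (hb n i hi.1 (by omega)).trans ?_
        have h₁ := one_le_one_add_log i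
        have h₀ : (0 : ℝ) < i := by exact_mod_cast hi.1
        have h₂ : Real.log i ≤ Real.log m := Real.log_le_log h₀ (by exact_mod_cast hi.2)
        rw [pow_one, div_eq_mul_inv]
        gcongr
      _ = C * (1 + Real.log m) ^ p * (harmonic m : ℝ) := by
        rw [harmonic_eq_sum_Icc, ← mul_sum]
        push_cast
        rfl
      _ ≤ C * (1 + Real.log m) ^ p * (1 + Real.log m) := by
        gcongr
        exact harmonic_le_one_add_log m
      _ = _ := by rw [pow_zero, div_one, pow_succ]; ring
  · choose! a ha using hl
    exact ⟨∑ i ∈ Ioc 0 m, a i, tendsto_finsetSum _ fun i hi => ha i (mem_Ioc.1 hi).1⟩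

lemma sum_Ioo (hv : HalfTame 1 v) : HalfTame 0 fun n m => ∑ i ∈ Ioo 0 m, v n i := by
  refine (hv.sum_Ioc.add (hv.mono zero_le_one).neg).congr fun n m hm _ => ?_
  rw [← Ioo_insert_right hm, sum_insert right_notMem_Ioo]
  ring

lemma summable_log_pow_div_sq (p : ℕ) :
    Summable fun m : ℕ => (1 + Real.log m) ^ p / (m : ℝ) ^ 2 := by
  have hlog : (fun m : ℕ => (1 + Real.log m) ^ p) =O[atTop] fun m : ℕ => (m : ℝ) ^ (1 / 2 : ℝ) := by
    have h₁ : (fun x : ℝ => 1 + Real.log x) =O[atTop] Real.log := by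
      refine Asymptotics.IsBigO.add ?_ (Asymptotics.isBigO_refl _ _)
      exact (Real.isLittleO_const_log_atTop (c := 1)).isBigO
    have h₂ := (isLittleO_log_rpow_rpow_atTop (p : ℝ) (by norm_num : (0 : ℝ) < 1 / 2)).isBigO
    simp only [Real.rpow_natCast] at h₂
    exact ((h₁.pow p).trans h₂).comp_tendsto tendsto_natCast_atTop_atTop
  refine summable_of_isBigO_nat
    (Real.summable_nat_rpow_inv.2 (by norm_num : (1 : ℝ) < 3 / 2)) ?_
  refine (hlog.mul (Asymptotics.isBigO_refl (fun m : ℕ => ((m : ℝ) ^ 2)⁻¹) atTop)).congr'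
    (.of_forall fun m => (div_eq_mul_inv _ _).symm) ?_
  filter_upwards [eventually_gt_atTop 0] with m hm
  have : (0 : ℝ) < m := by exact_mod_cast hm
  rw [← Real.rpow_natCast, ← Real.rpow_neg this.le, ← Real.rpow_neg this.le,
    ← Real.rpow_add this]
  norm_num

lemma tendsto_sum (hv : HalfTame 2 v) (P : ℕ → ℕ → Prop) [∀ n, DecidablePred (P n)]
    (hP : ∀ n m, P n m → 0 < m ∧ 2 * m ≤ n) (hP' : ∀ m, 0 < m → ∀ᶠ n in atTop, P n m) :
    ∃ a, Tendsto (fun n => ∑ m ∈ range n with P n m, v n m) atTop (𝓝 a) := by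
  obtain ⟨⟨C, hC, p, hb⟩, hl⟩ := hv
  choose! a ha using hl
  have key := tendsto_tsum_of_dominated_convergence (𝓕 := atTop)
    (f := fun n m => if P n m then v n m else 0) (g := fun m => if 0 < m then a m else 0)
    (bound := fun m : ℕ => C * ((1 + Real.log m) ^ p / (m : ℝ) ^ 2))
    ((summable_log_pow_div_sq p).mul_left C) (fun m => ?_) (.of_forall fun n m => ?_)
  · refine ⟨_, key.congr fun n => ?_⟩
    rw [sum_filter, tsum_eq_sum]
    intro m hm
    refine if_neg fun h => ?_
    have := hP n m h
    simp only [mem_range] at hm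
    omega
  · rcases Nat.eq_zero_or_pos m with rfl | hm
    · have (n : ℕ) : ¬ P n 0 := fun h => (hP n 0 h).1.ne rfl
      simp [this]
    · rw [if_pos hm]
      refine (ha m hm).congr' ?_
      filter_upwards [hP' m hm] with n hn
      rw [if_pos hn]
  · split_ifs with h
    · rw [← mul_div_assoc]
      exact hb n m (hP n m h).1 (hP n m h).2
    · rw [norm_zero]
      have : 0 ≤ Real.log m := Real.log_natCast_nonneg m
      positivity

end HalfTame

namespace Tame

variable {s t : ℕ} {v w : ℕ → ℕ → ℂ}

lemma congr (hv : Tame s v) (h : ∀ n m, 0 < m → m < n → v n m = w n m) : Tame s w :=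
  ⟨hv.1.congr fun n m _ _ => h n m (by omega) (by omega),
    hv.2.congr fun n m _ _ => h n (n - m) (by omega) (by omega)⟩

lemma mul (hv : Tame s v) (hw : Tame t w) : Tame (s + t) fun n m => v n m * w n m :=
  ⟨hv.1.mul hw.1, hv.2.mul hw.2⟩

lemma add (hv : Tame s v) (hw : Tame s w) : Tame s fun n m => v n m + w n m :=
  ⟨hv.1.add hw.1, hv.2.add hw.2⟩

lemma mono (hv : Tame s v) (hts : t ≤ s) : Tame t v :=
  ⟨hv.1.mono hts, hv.2.mono hts⟩

lemma const (c : ℂ) : Tame 0 fun _ _ => c :=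
  ⟨.of_tendsto tendsto_const_nhds, .of_tendsto tendsto_const_nhds⟩

lemma pow (hv : Tame s v) (p : ℕ) : Tame (s * p) fun n m => v n m ^ p := by
  induction p with
  | zero => simpa using const 1
  | succ p ih => simpa only [pow_succ, Nat.mul_succ] using ih.mul hv

end Tame

lemma sum_Ioo_zero_succ_s4 {M : Type*} [AddCommMonoid M] (g : ℕ → M) {m : ℕ} (hm : 0 < m) :
    ∑ i ∈ Ioo 0 (m + 1), g i = ∑ i ∈ Ioo 0 m, g i + g m := by
  rw [Ioo_add_one_right_eq_Ioc, ← Ioo_insert_right hm, sum_insert right_notMem_Ioo, add_comm]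

lemma sum_Ioo_zero_one {M : Type*} [AddCommMonoid M] (g : ℕ → M) :
    ∑ i ∈ Ioo 0 1, g i = 0 := by
  rw [show Ioo 0 1 = ∅ from rfl, sum_empty]

/-- The sums `∑_{0 < m < n} v n m` converge as `n → ∞`. -/
def SumConverges (v : ℕ → ℕ → ℂ) : Prop :=
  ∃ a, Tendsto (fun n => ∑ m ∈ Ioo 0 n, v n m) atTop (𝓝 a)

namespace SumConverges

variable {v w : ℕ → ℕ → ℂ}

lemma congr (hv : SumConverges v) (h : ∀ n m, 0 < m → m < n → v n m = w n m) :
    SumConverges w := by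
  obtain ⟨a, ha⟩ := hv
  refine ⟨a, ha.congr fun n => sum_congr rfl fun m hm => ?_⟩
  rw [mem_Ioo] at hm
  exact h n m hm.1 hm.2

lemma sub (hv : SumConverges v) (hw : SumConverges w) :
    SumConverges fun n m => v n m - w n m := by
  obtain ⟨a, ha⟩ := hv
  obtain ⟨b, hb⟩ := hw
  exact ⟨a - b, by simpa only [sum_sub_distrib] using ha.sub hb⟩

lemma const_mul (c : ℂ) (hv : SumConverges v) : SumConverges fun n m => c * v n m := by
  obtain ⟨a, ha⟩ := hv
  exact ⟨c * a, by simpa only [mul_sum] using ha.const_mul c⟩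

lemma telescope {a : ℂ} (h₁ : ∀ n, v n 1 = 0) (hv : Tendsto (fun n => v n n) atTop (𝓝 a)) :
    SumConverges fun n m => v n (m + 1) - v n m := by
  refine ⟨a, hv.congr' ?_⟩
  filter_upwards [eventually_ge_atTop 1] with n hn
  have key (m : ℕ) (hm : 1 ≤ m) : v n m = ∑ i ∈ Ioo 0 m, (v n (i + 1) - v n i) := by
    induction m, hm using Nat.le_induction with
    | base => rw [h₁, sum_Ioo_zero_one]
    | succ m hm ih =>
      rw [sum_Ioo_zero_succ_s4 _ hm, ← ih, add_sub_cancel]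
  exact key n hn

end SumConverges

lemma Tame.sumConverges {v : ℕ → ℕ → ℂ} (hv : Tame 2 v) : SumConverges v := by
  obtain ⟨a, ha⟩ := hv.1.tendsto_sum (fun n m => 0 < m ∧ 2 * m ≤ n) (fun _ _ h => h)
    fun m hm => (eventually_ge_atTop (2 * m)).mono fun n hn => ⟨hm, hn⟩
  obtain ⟨b, hb⟩ := hv.2.tendsto_sum (fun n m => 0 < m ∧ 2 * m < n)
    (fun _ _ h => ⟨h.1, h.2.le⟩)
    fun m hm => (eventually_gt_atTop (2 * m)).mono fun n hn => ⟨hm, hn⟩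
  refine ⟨a + b, (ha.add hb).congr fun n => ?_⟩
  rw [← sum_filter_add_sum_filter_not (Ioo 0 n) (fun m => 2 * m ≤ n)]
  congr 1
  · refine sum_congr ?_ fun _ _ => rfl
    ext m
    simp only [mem_filter, mem_range, mem_Ioo]
    omega
  · refine sum_bij' (fun m _ => n - m) (fun m _ => n - m) ?_ ?_ ?_ ?_ fun _ _ => rfl <;>
    · intro m hm
      simp only [mem_filter, mem_range, mem_Ioo] at hm ⊢
      omega

/-- The partial sums `∑_{0 < i < m} v n i`. -/
def partialSum (v : ℕ → ℕ → ℂ) (n m : ℕ) : ℂ := ∑ i ∈ Ioo 0 m, v n i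

lemma partialSum_one (v : ℕ → ℕ → ℂ) (n : ℕ) : partialSum v n 1 = 0 :=
  sum_Ioo_zero_one _

lemma partialSum_succ (v : ℕ → ℕ → ℂ) (n : ℕ) {m : ℕ} (hm : 0 < m) :
    partialSum v n (m + 1) = partialSum v n m + v n m :=
  sum_Ioo_zero_succ_s4 _ hm

lemma Tame.partialSum {v : ℕ → ℕ → ℂ} (hv : Tame 1 v) (hc : SumConverges v) :
    Tame 0 (partialSum v) := by
  refine ⟨hv.1.sum_Ioo, ?_⟩
  obtain ⟨a, ha⟩ := hc
  refine ((HalfTame.of_tendsto ha).add hv.2.sum_Ioc.neg).congr fun n m hm hn => ?_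
  have h : ∑ i ∈ Ioo 0 n, v n i
      = ∑ i ∈ Ioo 0 (n - m), v n i + ∑ i ∈ Ioc 0 m, v n (n - i) := by
    rw [← sum_filter_add_sum_filter_not (Ioo 0 n) (fun i => i < n - m)]
    congr 1
    · refine sum_congr ?_ fun _ _ => rfl
      ext i
      simp only [mem_filter, mem_Ioo]
      omega
    · refine sum_bij' (fun i _ => n - i) (fun i _ => n - i) ?_ ?_ ?_ ?_ ?_
      · intro i hi
        simp only [mem_filter, mem_Ioo, mem_Ioc] at hi ⊢
        omega
      · intro i hi
        simp only [mem_filter, mem_Ioo, mem_Ioc] at hi ⊢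
        omega
      · intro i hi
        simp only [mem_filter, mem_Ioo] at hi
        omega
      · intro i hi
        simp only [mem_Ioc] at hi
        omega
      · intro i hi
        simp only [mem_filter, mem_Ioo] at hi
        rw [Nat.sub_sub_self hi.1.2.le]
  simp only [h, _root_.partialSum]
  ring

/-- `w` is tame, and so are all the sums `∑_i F_i^p f_i w_i`, with `F` the partial sums
of `f`. -/
def LogSummable (f w : ℕ → ℕ → ℂ) : Prop :=
  Tame 0 w ∧ ∀ p : ℕ, SumConverges fun n m => partialSum f n m ^ p * (f n m * w n m)

lemma tame_add_pow_sub {F f : ℕ → ℕ → ℂ} (hF : Tame 0 F) (hf : Tame 1 f) (p : ℕ) :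
    Tame 2 fun n m => (F n m + f n m) ^ (p + 1) - F n m ^ (p + 1)
      - (p + 1) * (F n m ^ p * f n m) := by
  induction p with
  | zero =>
    refine (((Tame.const 0).mul hf).mul hf).congr fun n m _ _ => ?_
    norm_num
  | succ p ih =>
    have h₁ := (hF.add (hf.mono zero_le_one)).mul ih
    have h₂ := (((Tame.const (p + 1)).mul (hF.pow p)).mul hf).mul hf
    simp only [zero_mul, zero_add, Nat.reduceAdd] at h₁ h₂
    refine (h₁.add h₂).congr fun n m _ _ => ?_
    push_cast
    ring

lemma LogSummable.of_succ_eq_add {f u d : ℕ → ℕ → ℂ} {a : ℂ} (hf : Tame 1 f)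
    (hf' : SumConverges f) (hu : Tame 0 u) (hu' : Tendsto (fun n => u n n) atTop (𝓝 a))
    (hd : Tame 1 d) (hud : ∀ n m, 0 < m → m < n → u n (m + 1) = u n m + d n m)
    (hFd : ∀ p, SumConverges fun n m => partialSum f n m ^ p * d n m) : LogSummable f u := by
  refine ⟨hu, fun p => ?_⟩
  have hF := hf.partialSum hf'
  obtain ⟨b, hb⟩ := hf'
  have h₁ : SumConverges fun n m => partialSum f n (m + 1) ^ (p + 1) * u n (m + 1)
      - partialSum f n m ^ (p + 1) * u n m :=
    .telescope (v := fun n m => partialSum f n m ^ (p + 1) * u n m)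
      (fun n => by simp [partialSum_one]) ((hb.pow (p + 1)).mul hu')
  have h₂ := ((tame_add_pow_sub hF hf p).mul hu).sumConverges
  have h₃ : Tame 2 fun n m =>
      ((partialSum f n m + f n m) ^ (p + 1) - partialSum f n m ^ (p + 1)) * d n m := by
    have h := (((tame_add_pow_sub hF hf p).mono one_le_two).add
      (((Tame.const (p + 1)).mul (hF.pow p)).mul hf |>.mono (by omega))).mul hd
    refine h.congr fun n m _ _ => ?_
    ring
  refine ((((h₁.sub h₂).sub (hFd (p + 1))).sub h₃.sumConverges).const_mul
    ((p : ℂ) + 1)⁻¹).congr fun n m hm hn => ?_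
  have hp : (p : ℂ) + 1 ≠ 0 := by exact_mod_cast p.succ_ne_zero
  rw [hud n m hm hn, partialSum_succ f n hm]
  field_simp
  ring

lemma unitRoot_pow_self {n : ℕ} (hn : 0 < n) : unitRoot n ^ n = 1 :=
  (Complex.isPrimitiveRoot_exp n hn.ne').pow_eq_one

lemma unitRoot_pow_ne_one {n m : ℕ} (hm : 0 < m) (hn : m < n) : unitRoot n ^ m ≠ 1 :=
  (Complex.isPrimitiveRoot_exp n (by omega)).pow_ne_one_of_pos_of_lt hm.ne' hn

lemma unitRoot_pow_eq (n m : ℕ) :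
    unitRoot n ^ m = Complex.exp (Complex.I * (2 * Real.pi * m / n : ℝ)) := by
  rw [unitRoot, ← Complex.exp_nat_mul]
  push_cast
  congr 1
  ring

lemma norm_unitRoot_pow (n m : ℕ) : ‖unitRoot n ^ m‖ = 1 := by
  rw [unitRoot_pow_eq, Complex.norm_exp_I_mul_ofReal]

lemma norm_one_sub_unitRoot_pow (n m : ℕ) :
    ‖1 - unitRoot n ^ m‖ = 2 * |Real.sin (Real.pi * m / n)| := by
  rw [norm_sub_rev, unitRoot_pow_eq, Complex.norm_exp_I_mul_ofReal_sub_one, norm_mul,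
    Real.norm_eq_abs, Real.norm_eq_abs, abs_two]
  congr 3
  ring

lemma tendsto_unitRoot : Tendsto unitRoot atTop (𝓝 1) := by
  have h := (tendsto_const_div_atTop_nhds_zero_nat (2 * Real.pi * Complex.I)).cexp
  rwa [Complex.exp_zero] at h

lemma tendsto_natCast_mul_one_sub_unitRoot :
    Tendsto (fun n : ℕ => (n : ℂ) * (1 - unitRoot n)) atTop (𝓝 (-(2 * Real.pi * Complex.I))) := by
  have hc : 2 * Real.pi * Complex.I ≠ 0 := Complex.two_pi_I_ne_zero
  have h₁ := (Complex.hasDerivAt_exp 0).tendsto_slope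
  have h₂ : Tendsto (fun n : ℕ => 2 * Real.pi * Complex.I / n) atTop (𝓝[≠] 0) := by
    refine tendsto_nhdsWithin_iff.2 ⟨tendsto_const_div_atTop_nhds_zero_nat _, ?_⟩
    filter_upwards [eventually_gt_atTop 0] with n hn
    exact div_ne_zero hc (by exact_mod_cast hn.ne')
  have h₃ := (h₁.comp h₂).const_mul (-(2 * Real.pi * Complex.I))
  rw [Complex.exp_zero, mul_one] at h₃
  refine h₃.congr' ?_
  filter_upwards [eventually_gt_atTop 0] with n hn
  have : (n : ℂ) ≠ 0 := by exact_mod_cast hn.ne'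
  simp only [Function.comp_apply, slope_def_field, Complex.exp_zero, unitRoot, sub_zero]
  field_simp
  ring

lemma tame_unitRoot_pow : Tame 0 fun n m => unitRoot n ^ m := by
  have hl (m : ℕ) : Tendsto (fun n => unitRoot n ^ m) atTop (𝓝 1) := by
    simpa using tendsto_unitRoot.pow m
  refine ⟨⟨⟨1, zero_le_one, 0, fun n m _ _ => ?_⟩, fun m _ => ⟨1, hl m⟩⟩,
    ⟨⟨1, zero_le_one, 0, fun n m _ _ => ?_⟩, fun m _ => ⟨1, ?_⟩⟩⟩
  · simpa using (norm_unitRoot_pow n m).le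
  · simpa using (norm_unitRoot_pow n (n - m)).le
  · have h := (hl m).inv₀ one_ne_zero
    rw [inv_one] at h
    refine h.congr' ?_
    filter_upwards [eventually_gt_atTop m] with n hn
    rw [inv_eq_iff_eq_inv]
    refine eq_inv_of_mul_eq_one_left ?_
    rw [← pow_add, Nat.add_sub_cancel' hn.le, unitRoot_pow_self (by omega)]

lemma inv_qint_unitRoot_sub {n m : ℕ} (hm : 0 < m) (hn : m < n) :
    (qint (unitRoot n) (n - m))⁻¹ = -(unitRoot n ^ m * (qint (unitRoot n) m)⁻¹) := by
  have h₁ : unitRoot n ^ (n - m) * unitRoot n ^ m = 1 := by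
    rw [← pow_add, Nat.sub_add_cancel hn.le, unitRoot_pow_self (by omega)]
  have h₂ := sub_ne_zero.2 (unitRoot_pow_ne_one hm hn).symm
  have h₃ := sub_ne_zero.2 (unitRoot_pow_ne_one (Nat.sub_pos_of_lt hn) (by omega : n - m < n)).symm
  rw [qint, qint, inv_div, inv_div]
  field_simp
  linear_combination (unitRoot n - 1) * h₁

lemma halfTame_inv_qint : HalfTame 1 fun n m => (qint (unitRoot n) m)⁻¹ := by
  refine ⟨⟨Real.pi / 2, by positivity, 0, fun n m hm hn => ?_⟩, fun m hm => ⟨(m : ℂ)⁻¹, ?_⟩⟩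
  · have hn' : (0 : ℝ) < n := by exact_mod_cast (by omega : 0 < n)
    have hm' : (0 : ℝ) < m := by exact_mod_cast hm
    have hmn : 2 * (m : ℝ) ≤ n := by exact_mod_cast hn
    have h₁ : ‖1 - unitRoot n‖ ≤ 2 * (Real.pi / n) := by
      have h := norm_one_sub_unitRoot_pow n 1
      rw [pow_one, Nat.cast_one, mul_one] at h
      rw [h]
      have := Real.abs_sin_le_abs (x := Real.pi / n)
      rw [abs_of_pos (a := Real.pi / n) (by positivity)] at this
      gcongr
    have h₂ : 4 * (m / n : ℝ) ≤ ‖1 - unitRoot n ^ m‖ := by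
      rw [norm_one_sub_unitRoot_pow]
      have h := Real.mul_le_sin (x := Real.pi * m / n) (by positivity) (by
        rw [div_le_div_iff₀ hn' two_pos]
        nlinarith [Real.pi_pos])
      have h' : 2 / Real.pi * (Real.pi * m / n) = 2 * (m / n : ℝ) := by
        field_simp
      linarith [le_abs_self (Real.sin (Real.pi * m / n))]
    change ‖(qint (unitRoot n) m)⁻¹‖ ≤ _
    rw [qint, inv_div, norm_div, pow_zero, mul_one, pow_one]
    calc ‖1 - unitRoot n‖ / ‖1 - unitRoot n ^ m‖ ≤ 2 * (Real.pi / n) / (4 * (m / n : ℝ)) := by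
          gcongr
      _ = _ := by
        field_simp
        norm_num
  · have h : Tendsto (fun n => ∑ i ∈ range m, unitRoot n ^ i) atTop (𝓝 (m : ℂ)) := by
      simpa using tendsto_finsetSum (range m) fun i _ => tendsto_unitRoot.pow i
    refine (h.inv₀ (by exact_mod_cast hm.ne')).congr' ?_
    filter_upwards [eventually_gt_atTop 1] with n hn
    have h₁ := unitRoot_pow_ne_one one_pos hn
    rw [pow_one] at h₁
    rw [geom_sum_eq h₁, qint, ← neg_div_neg_eq, neg_sub, neg_sub]

lemma tame_inv_qint : Tame 1 fun n m => (qint (unitRoot n) m)⁻¹ := by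
  refine ⟨halfTame_inv_qint,
    (tame_unitRoot_pow.1.mul halfTame_inv_qint).neg.congr fun n m hm hn => ?_⟩
  exact (inv_qint_unitRoot_sub hm (by omega)).symm

lemma sumConverges_inv_qint : SumConverges fun n m => (qint (unitRoot n) m)⁻¹ := by
  have h₀ : Tendsto (fun n : ℕ => ((n : ℂ) * (1 - unitRoot n) - (1 - unitRoot n)) / 2) atTop
      (𝓝 ((-(2 * Real.pi * Complex.I) - (1 - 1)) / 2)) :=
    (tendsto_natCast_mul_one_sub_unitRoot.sub (tendsto_unitRoot.const_sub 1)).div_const 2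
  refine ⟨_, h₀.congr' ?_⟩
  filter_upwards [eventually_gt_atTop 0] with n hn
  have h₁ : ∑ m ∈ Ioo 0 n, (qint (unitRoot n) m)⁻¹
      = ∑ m ∈ Ioo 0 n, (qint (unitRoot n) (n - m))⁻¹ := by
    refine sum_bij' (fun m _ => n - m) (fun m _ => n - m) ?_ ?_ ?_ ?_ ?_ <;>
    · intro m hm
      simp only [mem_Ioo] at hm ⊢
      first
      | omega
      | rw [Nat.sub_sub_self hm.2.le]
  have h₂ : ∑ m ∈ Ioo 0 n, (qint (unitRoot n) m)⁻¹
      + ∑ m ∈ Ioo 0 n, (qint (unitRoot n) (n - m))⁻¹ = (n - 1) * (1 - unitRoot n) := by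
    rw [← sum_add_distrib]
    trans ∑ m ∈ Ioo 0 n, (1 - unitRoot n)
    · refine sum_congr rfl fun m hm => ?_
      rw [mem_Ioo] at hm
      have h := sub_ne_zero.2 (unitRoot_pow_ne_one hm.1 hm.2).symm
      rw [inv_qint_unitRoot_sub hm.1 hm.2, qint, inv_div]
      field_simp
      ring
    · rw [sum_const, Nat.card_Ioo, nsmul_eq_mul, Nat.sub_zero, Nat.cast_sub hn, Nat.cast_one]
  rw [← h₁] at h₂
  linear_combination (-1 / 2) * h₂

lemma tame_letter {k : ℕ} :
    Tame k fun n m => unitRoot n ^ ((k - 1) * m) / qint (unitRoot n) m ^ k := by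
  have h := (tame_unitRoot_pow.pow (k - 1)).mul (tame_inv_qint.pow k)
  rw [zero_mul, zero_add, one_mul] at h
  refine h.congr fun n m _ _ => ?_
  rw [mul_comm (k - 1), pow_mul, inv_pow, div_eq_mul_inv]

lemma logSummable_zq (l : List ℕ) (hl : ∀ i ∈ l, 0 < i) :
    LogSummable (fun n m => (qint (unitRoot n) m)⁻¹) (fun n m => zq (unitRoot n) l m) ∧
      ∃ a, Tendsto (fun n => zq (unitRoot n) l n) atTop (𝓝 a) := by
  induction l with
  | nil =>
    have h : Tendsto (fun n => zq (unitRoot n) [] n) atTop (𝓝 1) := tendsto_const_nhds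
    refine ⟨?_, 1, h⟩
    refine .of_succ_eq_add (d := fun _ _ => 0) tame_inv_qint sumConverges_inv_qint (.const 1) h
      ((Tame.const 0).mul tame_inv_qint |>.congr fun _ _ _ _ => zero_mul _)
      (fun _ _ _ _ => (add_zero _).symm) fun p => ⟨0, ?_⟩
    simp
  | cons k ks ih =>
    obtain ⟨ih, -⟩ := ih fun i hi => hl i (List.mem_cons_of_mem k hi)
    have hk : 0 < k := hl k List.mem_cons_self
    set d : ℕ → ℕ → ℂ := fun n m =>
      unitRoot n ^ ((k - 1) * m) / qint (unitRoot n) m ^ k * zq (unitRoot n) ks m with hd_def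
    have hd : Tame k d := tame_letter.mul ih.1
    have hd₁ : Tame 1 d := hd.mono hk
    have hFd (p : ℕ) : SumConverges fun n m =>
        partialSum (fun n m => (qint (unitRoot n) m)⁻¹) n m ^ p * d n m := by
      obtain rfl | hk₂ := (Nat.succ_le_iff.2 hk).eq_or_lt
      · refine (ih.2 p).congr fun n m _ _ => ?_
        simp [hd_def]
      · have hF := tame_inv_qint.partialSum sumConverges_inv_qint
        exact (((hF.pow p).mul hd).mono (by omega)).sumConverges
    have hdc : SumConverges d := (hFd 0).congr fun n m _ _ => by rw [pow_zero, one_mul]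
    obtain ⟨a, ha⟩ := hdc
    exact ⟨.of_succ_eq_add tame_inv_qint sumConverges_inv_qint (hd₁.partialSum ⟨a, ha⟩) ha hd₁
      (fun n m hm _ => partialSum_succ d n hm) hFd, a, ha⟩

/-- `g` is a combination of the sums `z(l)`, over indices `l` with positive entries, with
coefficients positive powers of `1 - q`. -/
def IsErrorTerm (g : ℂ → ℕ → ℂ) : Prop :=
  ∃ A : List (ℕ × List ℕ), (∀ x ∈ A, ∀ i ∈ x.2, 0 < i) ∧
    ∀ q m, (∀ i, 0 < i → i < m → q ^ i ≠ 1) →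
      g q m = (A.map fun x => (1 - q) ^ (x.1 + 1) * zq q x.2 m).sum

namespace IsErrorTerm

variable {g h : ℂ → ℕ → ℂ}

lemma zero : IsErrorTerm fun _ _ => 0 :=
  ⟨[], by simp, by simp⟩

lemma congr (hg : IsErrorTerm g)
    (hgh : ∀ q m, (∀ i, 0 < i → i < m → q ^ i ≠ 1) → g q m = h q m) : IsErrorTerm h := by
  obtain ⟨A, hA, hg⟩ := hg
  exact ⟨A, hA, fun q m hq => (hgh q m hq).symm.trans (hg q m hq)⟩

lemma add (hg : IsErrorTerm g) (hh : IsErrorTerm h) :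
    IsErrorTerm fun q m => g q m + h q m := by
  obtain ⟨A, hA, hg⟩ := hg
  obtain ⟨B, hB, hh⟩ := hh
  refine ⟨A ++ B, fun x hx => ?_, fun q m hq => ?_⟩
  · exact (List.mem_append.1 hx).elim (hA x) (hB x)
  · simp only [hg q m hq, hh q m hq, List.map_append, List.sum_append]

lemma one_sub_mul (hg : IsErrorTerm g) : IsErrorTerm fun q m => (1 - q) * g q m := by
  obtain ⟨A, hA, hg⟩ := hg
  refine ⟨A.map fun x => (x.1 + 1, x.2), List.forall_mem_map.2 fun x hx => hA x hx, fun q m hq => ?_⟩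
  simp only [hg q m hq, ← List.sum_map_mul_left, List.map_map]
  congr 2
  funext x
  simp only [Function.comp_apply]
  ring

lemma one_sub_mul_sum (L : List (List ℕ)) (hL : ∀ l ∈ L, ∀ i ∈ l, 0 < i) :
    IsErrorTerm fun q m => (1 - q) * (L.map fun l => zq q l m).sum := by
  refine ⟨L.map fun l => (0, l), List.forall_mem_map.2 hL, fun q m _ => ?_⟩
  simp only [← List.sum_map_mul_left, List.map_map]
  congr 2
  funext l
  simp

lemma sum_letter (hg : IsErrorTerm g) {k : ℕ} (hk : 0 < k) :
    IsErrorTerm fun q m => ∑ i ∈ Ioo 0 m, q ^ ((k - 1) * i) / qint q i ^ k * g q i := by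
  obtain ⟨A, hA, hg⟩ := hg
  refine ⟨A.map fun x => (x.1, k :: x.2), ?_, fun q m hq => ?_⟩
  · simp only [List.mem_map, forall_exists_index, and_imp]
    rintro _ x hx rfl i hi
    exact (List.mem_cons.1 hi).elim (fun h => h ▸ hk) (hA x hx i)
  · have h₁ : ∀ i ∈ Ioo 0 m, q ^ ((k - 1) * i) / qint q i ^ k * g q i
        = q ^ ((k - 1) * i) / qint q i ^ k
          * (A.map fun x => (1 - q) ^ (x.1 + 1) * zq q x.2 i).sum := fun i hi => by
      rw [mem_Ioo] at hi
      rw [hg q i fun j hj hji => hq j hj (hji.trans hi.2)]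
    simp only [sum_congr rfl h₁, List.map_map]
    clear hA hg h₁
    induction A with
    | nil => simp
    | cons x A ih =>
      simp only [List.map_cons, List.sum_cons, mul_add, sum_add_distrib, ih,
        Function.comp_apply, zq, mul_sum]
      congr 1
      refine sum_congr rfl fun i _ => ?_
      ring

lemma tendsto_zero (hg : IsErrorTerm g) :
    Tendsto (fun n => g (unitRoot n) n) atTop (𝓝 0) := by
  obtain ⟨A, hA, hg⟩ := hg
  simp only [hg (unitRoot _) _ fun i hi hin => unitRoot_pow_ne_one hi hin]
  clear hg
  induction A with
  | nil => simp
  | cons x A ih =>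
    obtain ⟨a, ha⟩ := (logSummable_zq x.2 (hA x List.mem_cons_self)).2
    have h := (((tendsto_unitRoot.const_sub 1).pow (x.1 + 1)).mul ha).add
      (ih fun y hy => hA y (List.mem_cons_of_mem x hy))
    simpa using h

end IsErrorTerm

lemma letter_mul_letter {q : ℂ} {i k l : ℕ} (hk : 0 < k) (hl : 0 < l) (hq : q ≠ 1)
    (hqi : q ^ i ≠ 1) :
    q ^ ((k - 1) * i) / qint q i ^ k * (q ^ ((l - 1) * i) / qint q i ^ l)
      = q ^ ((k + l - 1) * i) / qint q i ^ (k + l)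
        + (1 - q) * (q ^ ((k + l - 1 - 1) * i) / qint q i ^ (k + l - 1)) := by
  obtain ⟨k, rfl⟩ := Nat.exists_eq_succ_of_ne_zero hk.ne'
  obtain ⟨l, rfl⟩ := Nat.exists_eq_succ_of_ne_zero hl.ne'
  have h₁ : 1 - q ≠ 0 := sub_ne_zero.2 hq.symm
  have h₂ : 1 - q ^ i ≠ 0 := sub_ne_zero.2 hqi.symm
  have h₃ : qint q i ≠ 0 := div_ne_zero h₂ h₁
  have h₄ : (1 - q) * qint q i = 1 - q ^ i := mul_div_cancel₀ _ h₁
  have e₁ : k.succ - 1 = k := rfl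
  have e₂ : l.succ - 1 = l := rfl
  have e₃ : k.succ + l.succ = k + l + 2 := by omega
  have e₄ : k + l + 2 - 1 = k + l + 1 := rfl
  have e₅ : k + l + 1 - 1 = k + l := rfl
  rw [e₁, e₂, e₃, e₄, e₅, div_mul_div_comm, ← pow_add, ← pow_add, e₃, ← add_mul,
    pow_succ (qint q i) (k + l + 1)]
  field_simp
  rw [add_mul (k + l) 1 i, pow_add, one_mul]
  linear_combination (-q ^ ((k + l) * i)) * h₄

lemma contractions_cons_cons (k l : ℕ) (ks : List ℕ) :
    contractions (k :: l :: ks) = (contractions (l :: ks)).map (k :: ·)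
      ++ contractions ((k + l) :: ks) := by
  change _ ++ (contractions (l :: ks)).map (fun l' => (k + l'.headI) :: l'.tail) = _
  congr 1
  cases ks with
  | nil => rfl
  | cons m ks =>
    change List.map _ (_ ++ _) = _ ++ _
    simp only [List.map_append, List.map_map, Function.comp_def, List.headI_cons,
      List.tail_cons, add_assoc]

lemma pos_of_mem_contractions (l : List ℕ) (hl : ∀ i ∈ l, 0 < i) :
    ∀ l' ∈ contractions l, ∀ i ∈ l', 0 < i := by
  induction hn : l.length generalizing l with
  | zero =>
    rw [List.length_eq_zero_iff] at hn
    simp [hn, contractions]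
  | succ n ih =>
    match l, hl, hn with
    | [k], hl, _ => simpa [contractions] using hl
    | k :: l :: ks, hl, hn =>
      simp only [List.mem_cons, forall_eq_or_imp] at hl
      intro l' hl' i hi
      rw [contractions_cons_cons, List.mem_append, List.mem_map] at hl'
      rcases hl' with ⟨l', hl', rfl⟩ | hl'
      · rcases List.mem_cons.1 hi with rfl | hi
        · exact hl.1
        · exact ih (l :: ks) (by simpa using hl.2) (by simpa using hn) l' hl' i hi
      · exact ih ((k + l) :: ks) (by simpa using ⟨Or.inl hl.1, hl.2.2⟩) (by simpa using hn)
          l' hl' i hi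

lemma isErrorTerm_zqStar_sub (l : List ℕ) (hl : ∀ i ∈ l, 0 < i) :
    IsErrorTerm fun q m => zqStar q l m - ((contractions l).map fun l' => zq q l' m).sum := by
  induction hn : l.length generalizing l with
  | zero =>
    rw [List.length_eq_zero_iff] at hn
    subst hn
    exact IsErrorTerm.zero.congr fun q m _ => by simp [contractions, zq, zqStar]
  | succ n ih =>
    match l, hl, hn with
    | [k], hl, _ =>
      exact IsErrorTerm.zero.congr fun q m _ => by simp [contractions, zq, zqStar]
    | k :: l :: ks, hl, hn =>
      simp only [List.mem_cons, forall_eq_or_imp] at hl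
      obtain ⟨hk, hl, hks⟩ := hl
      have h₁ := (ih (l :: ks) (by simpa using ⟨hl, hks⟩) (by simpa using hn)).sum_letter hk
      have h₂ := ih ((k + l) :: ks) (by simpa using ⟨Or.inl hk, hks⟩) (by simpa using hn)
      have hpos : ∀ i ∈ (k + l - 1) :: ks, 0 < i := by
        simp only [List.mem_cons, forall_eq_or_imp]
        exact ⟨by omega, hks⟩
      have h₃ := (ih _ hpos (by simpa using hn)).one_sub_mul
      have h₄ := IsErrorTerm.one_sub_mul_sum _ (pos_of_mem_contractions _ hpos)
      refine (((h₁.add h₂).add h₃).add h₄).congr fun q m hq => ?_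
      have e₁ : zqStar q (k :: l :: ks) m
          = ∑ i ∈ Ioo 0 m, q ^ ((k - 1) * i) / qint q i ^ k * zqStar q (l :: ks) i
            + zqStar q ((k + l) :: ks) m + (1 - q) * zqStar q ((k + l - 1) :: ks) m := by
        simp only [zqStar]
        rw [mul_sum, ← sum_add_distrib, ← sum_add_distrib]
        refine sum_congr rfl fun i hi => ?_
        rw [mem_Ioo] at hi
        have hq₁ : q ≠ 1 := by simpa using hq 1 one_pos (by omega)
        rw [sum_Ioo_zero_succ_s4 _ hi.1]
        linear_combination zqStar q ks (i + 1)
          * letter_mul_letter hk hl hq₁ (hq i hi.1 hi.2)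
      have e₂ : ∑ i ∈ Ioo 0 m, q ^ ((k - 1) * i) / qint q i ^ k
            * ((contractions (l :: ks)).map fun l' => zq q l' i).sum
          = ((contractions (l :: ks)).map fun l' => zq q (k :: l') m).sum := by
        generalize contractions (l :: ks) = L
        induction L with
        | nil => simp
        | cons x L ihL => simp [mul_add, sum_add_distrib, ihL, zq]
      rw [e₁, contractions_cons_cons, List.map_append, List.sum_append, List.map_map]
      simp only [mul_sub, sum_sub_distrib, e₂, Function.comp_def]
      ring

/-- For every index `k = (k_1,…,k_r)`, the limits `ξ(l) = lim_n z_n(l; e^{2πi/n})`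
(for every contraction `l` of `k`) and `ξ^⋆(k) = lim_n z_n^⋆(k; e^{2πi/n})` exist, and
`ξ^⋆(k_1,…,k_r) = ∑_{(l_1,…,l_s)} ξ(l_1,…,l_s)`, the sum ranging over all indices
obtained from `(k_1,…,k_r)` by summing consecutive blocks of entries. -/
theorem stmt_4 (k : List ℕ) (hk : k ≠ []) (hpos : ∀ i ∈ k, 0 < i) :
    ∃ ξstar : ℂ, ∃ ξ : List ℕ → ℂ,
      Tendsto (fun n : ℕ => zqStar (Complex.exp (2 * Real.pi * Complex.I / n)) k n)
        atTop (nhds ξstar) ∧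
      (∀ l ∈ contractions k,
        Tendsto (fun n : ℕ => zq (Complex.exp (2 * Real.pi * Complex.I / n)) l n)
          atTop (nhds (ξ l))) ∧
      ξstar = ((contractions k).map ξ).sum := by
  have hlim (l : List ℕ) (hl : ∀ i ∈ l, 0 < i) := (logSummable_zq l hl).2
  choose! ξ hξ using hlim
  have hmem := pos_of_mem_contractions k hpos
  refine ⟨((contractions k).map ξ).sum, ξ, ?_, fun l hl => hξ l (hmem l hl), rfl⟩
  have h₁ : Tendsto (fun n => ((contractions k).map fun l => zq (unitRoot n) l n).sum) atTop
      (𝓝 ((contractions k).map ξ).sum) :=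
    tendsto_list_sum _ fun l hl => hξ l (hmem l hl)
  have h₂ := (isErrorTerm_zqStar_sub k hpos).tendsto_zero.add h₁
  simp only [sub_add_cancel, zero_add] at h₂
  exact h₂
end

section
/- Let k = (k_1,…,k_r) be an admissible index (i.e. k_1 ≥ 2). Then there exist a constant C > 0 and a positive integer J such that for all integers n ≥ 2, |A_n^+(k) − ζ(k)| ≤ C (log n)^J / n, where ζ(k) = ∑_{m_1>⋯>m_r>0} ∏_{j=1}^r m_j^{−k_j} is the (convergent) multiple zeta value. -/
open Filter

/-- `Aplus n k B = ∑_{B ≥ m_1 > ⋯ > m_r > 0} ∏_j e^{iπ(k_j-2)m_j/n} / ((n/π) sin(π m_j/n))^{k_j}`;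
the quantity `A_n^+(k)` of the paper is `Aplus n k ⌊n/2⌋` (note `m ≤ n/2 ↔ m ≤ ⌊n/2⌋`
for an integer `m`). -/
noncomputable def Aplus (n : ℕ) : List ℕ → ℕ → ℂ
  | [], _ => 1
  | k :: ks, B => ∑ m ∈ Finset.Icc 1 B,
      Complex.exp (Real.pi * Complex.I * ((k : ℂ) - 2) * m / n) /
        ((((n : ℝ) / Real.pi) * Real.sin (Real.pi * m / n) : ℝ) : ℂ) ^ k * Aplus n ks (m - 1)

/-- The truncated multiple harmonic sum
`∑_{n > m_1 > ⋯ > m_r > 0} ∏_j m_j^{-k_j}` (a real number); its limit as `n → ∞` is the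
multiple zeta value `ζ(k)` when `k` is admissible. -/
noncomputable def mhsR : List ℕ → ℕ → ℝ
  | [], _ => 1
  | k :: ks, n => ∑ m ∈ Finset.Ioo 0 n, (1 / (m : ℝ) ^ k) * mhsR ks m

/-- The factor attached to the exponent `k` and the summation variable `m` in `Aplus n`. -/
noncomputable def sineWeight (n k m : ℕ) : ℂ :=
  Complex.exp (Real.pi * Complex.I * ((k : ℂ) - 2) * m / n) /
    ((((n : ℝ) / Real.pi) * Real.sin (Real.pi * m / n) : ℝ) : ℂ) ^ k

lemma Aplus_cons (n k : ℕ) (ks : List ℕ) (B : ℕ) :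
    Aplus n (k :: ks) B = ∑ m ∈ Finset.Icc 1 B, sineWeight n k m * Aplus n ks (m - 1) := rfl

lemma mhsR_cons (k : ℕ) (ks : List ℕ) (n : ℕ) :
    mhsR (k :: ks) n = ∑ m ∈ Finset.Ioo 0 n, (1 / (m : ℝ) ^ k) * mhsR ks m := rfl

lemma div_sin_bounds {x : ℝ} (hx : 0 < x) (hx' : x ≤ Real.pi / 2) :
    0 < Real.sin x ∧ 1 ≤ x / Real.sin x ∧ x / Real.sin x ≤ 2 ∧ x / Real.sin x - 1 ≤ x := by
  have hs : 0 < Real.sin x := Real.sin_pos_of_pos_of_lt_pi hx (by linarith [Real.pi_pos])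
  have hlt := Real.sin_lt hx
  have hj := Real.mul_le_sin hx.le hx'
  have hhalf : x / 2 ≤ Real.sin x := by
    refine le_trans ?_ hj
    have : (1 : ℝ) / 2 ≤ 2 / Real.pi := by
      rw [div_le_div_iff₀ two_pos Real.pi_pos]; linarith [Real.pi_le_four]
    nlinarith
  have h2 : x / Real.sin x ≤ 2 := by rw [div_le_iff₀ hs]; linarith
  refine ⟨hs, by rw [le_div_iff₀ hs]; linarith, h2, ?_⟩
  rcases le_total x 1 with h1 | h1
  · have hc := Real.sin_gt_sub_cube hx
    rw [sub_le_iff_le_add, div_le_iff₀ hs]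
    nlinarith [mul_le_mul_of_nonneg_left hhalf hx.le, mul_pos hx hx]
  · linarith

lemma norm_exp_mul_pow_sub_one_le (k : ℕ) {x : ℝ} (hx : 0 < x) (hx' : x ≤ Real.pi / 2) :
    ‖Complex.exp (Complex.I * (((k : ℝ) - 2) * x : ℝ)) * ((x / Real.sin x : ℝ) : ℂ) ^ k - 1‖
      ≤ ((2 * k + 2) * 2 ^ k) * x := by
  obtain ⟨hs, h1, h2, h3⟩ := div_sin_bounds hx hx'
  set y := x / Real.sin x
  set u := Complex.exp (Complex.I * (((k : ℝ) - 2) * x : ℝ))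
  have hu : ‖u - 1‖ ≤ (k + 2) * x := by
    refine (Real.norm_exp_I_mul_ofReal_sub_one_le).trans ?_
    rw [Real.norm_eq_abs, abs_mul, abs_of_pos hx]
    gcongr
    rw [abs_le]
    constructor <;> linarith [(Nat.cast_nonneg k : (0 : ℝ) ≤ k)]
  have hv : ‖(y : ℂ) ^ k‖ ≤ 2 ^ k := by
    rw [norm_pow, Complex.norm_real, Real.norm_eq_abs, abs_of_nonneg (by linarith)]
    gcongr
  have hv1 : ‖(y : ℂ) ^ k - 1‖ ≤ k * 2 ^ k * x := by
    have e : (y : ℂ) ^ k - 1 = ((y ^ k - 1 ^ k : ℝ) : ℂ) := by push_cast; simp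
    rw [e, Complex.norm_real, Real.norm_eq_abs]
    refine (abs_pow_sub_pow_le _ _ _).trans ?_
    rw [abs_of_nonneg (by linarith : (0 : ℝ) ≤ y - 1), abs_one, abs_of_nonneg (by linarith : 0 ≤ y),
      max_eq_left h1]
    calc (y - 1) * k * y ^ (k - 1) ≤ x * k * 2 ^ k := by
          gcongr
          exact (pow_le_pow_left₀ (by linarith) h2 _).trans
            (pow_le_pow_right₀ (by norm_num) (Nat.sub_le _ _))
      _ = _ := by ring
  calc ‖u * (y : ℂ) ^ k - 1‖ = ‖(u - 1) * (y : ℂ) ^ k + ((y : ℂ) ^ k - 1)‖ := by ring_nf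
    _ ≤ ‖u - 1‖ * ‖(y : ℂ) ^ k‖ + ‖(y : ℂ) ^ k - 1‖ :=
        (norm_add_le _ _).trans (by rw [norm_mul])
    _ ≤ ((k + 2) * x) * 2 ^ k + k * 2 ^ k * x := by gcongr
    _ = _ := by ring

lemma norm_sineWeight_sub_le (k : ℕ) : ∃ C : ℝ, 0 ≤ C ∧ ∀ n m : ℕ, 0 < m → m ≤ n / 2 →
    ‖sineWeight n k m - ((1 / (m : ℝ) ^ k : ℝ) : ℂ)‖ ≤ C * (m / n) / m ^ k := by
  refine ⟨((2 * k + 2) * 2 ^ k) * Real.pi, by positivity, fun n m hm hmn => ?_⟩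
  have hn : 0 < n := by omega
  have hm' : (0 : ℝ) < m := by exact_mod_cast hm
  have hn' : (0 : ℝ) < n := by exact_mod_cast hn
  have h2 : 2 * (m : ℝ) ≤ n := by exact_mod_cast (by omega : 2 * m ≤ n)
  set x : ℝ := Real.pi * m / n with hxdef
  have hx : 0 < x := by have := Real.pi_pos; positivity
  have hx' : x ≤ Real.pi / 2 := by
    rw [hxdef, div_le_div_iff₀ hn' two_pos]; nlinarith [Real.pi_pos]
  have hs := (div_sin_bounds hx hx').1
  have key := norm_exp_mul_pow_sub_one_le k hx hx'
  have e : sineWeight n k m - ((1 / (m : ℝ) ^ k : ℝ) : ℂ) =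
      (Complex.exp (Complex.I * (((k : ℝ) - 2) * x : ℝ)) * ((x / Real.sin x : ℝ) : ℂ) ^ k - 1) *
        ((1 / (m : ℝ) ^ k : ℝ) : ℂ) := by
    have e1 : (Real.pi * Complex.I * ((k : ℂ) - 2) * m / n : ℂ) =
        Complex.I * (((k : ℝ) - 2) * x : ℝ) := by
      rw [hxdef]; push_cast; ring
    have e2 : (n : ℝ) / Real.pi * Real.sin x = m / (x / Real.sin x) := by
      have := Real.pi_pos.ne'
      have := hs.ne'
      have := hn'.ne'
      have := hm'.ne'
      generalize Real.sin x = s at *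
      rw [hxdef]
      field_simp
    rw [sineWeight, e1, ← hxdef, e2]
    push_cast
    rw [div_pow, div_div_eq_mul_div, sub_mul]
    ring
  rw [e, norm_mul, Complex.norm_real, Real.norm_eq_abs, abs_of_pos (by positivity)]
  calc _ ≤ ((2 * k + 2) * 2 ^ k) * x * (1 / (m : ℝ) ^ k) := by gcongr
    _ = _ := by rw [hxdef]; ring

lemma mhsR_nonneg : ∀ (ks : List ℕ) (n : ℕ), 0 ≤ mhsR ks n
  | [], _ => zero_le_one
  | k :: ks, n => by
    rw [mhsR_cons]
    exact Finset.sum_nonneg fun m _ => mul_nonneg (by positivity) (mhsR_nonneg ks m)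

lemma sum_Icc_inv_le (B : ℕ) : ∑ m ∈ Finset.Icc 1 B, (1 : ℝ) / m ≤ 1 + Real.log B := by
  have h := harmonic_le_one_add_log B
  rw [harmonic_eq_sum_Icc] at h
  push_cast at h
  simpa only [one_div] using h

lemma log_natCast_le {m n : ℕ} (hm : 0 < m) (h : m ≤ n) : Real.log m ≤ Real.log n :=
  Real.log_le_log (by exact_mod_cast hm) (by exact_mod_cast h)

lemma one_div_pow_le_one_div {m k : ℕ} (hm : 0 < m) (hk : 0 < k) :
    1 / (m : ℝ) ^ k ≤ 1 / m := by
  have hm' : (1 : ℝ) ≤ m := by exact_mod_cast hm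
  exact one_div_le_one_div_of_le (by linarith) (le_self_pow₀ hm' hk.ne')

lemma mhsR_le (ks : List ℕ) (hpos : ∀ i ∈ ks, 0 < i) (n : ℕ) (hn : 0 < n) :
    mhsR ks n ≤ (1 + Real.log n) ^ ks.length := by
  induction ks generalizing n with
  | nil => simp [mhsR]
  | cons k ks ih =>
    have hlog : 0 ≤ Real.log n := Real.log_natCast_nonneg n
    rw [mhsR_cons, List.length_cons, pow_succ']
    calc ∑ m ∈ Finset.Ioo 0 n, (1 / (m : ℝ) ^ k) * mhsR ks m
        ≤ ∑ m ∈ Finset.Ioo 0 n, (1 / (m : ℝ)) * (1 + Real.log n) ^ ks.length := by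
          refine Finset.sum_le_sum fun m hm => ?_
          rw [Finset.mem_Ioo] at hm
          have h1 := log_natCast_le hm.1 hm.2.le
          have h0 : 0 ≤ Real.log m := Real.log_natCast_nonneg m
          refine mul_le_mul (one_div_pow_le_one_div hm.1 (hpos k (by simp))) ?_ (mhsR_nonneg _ _)
            (by positivity)
          exact (ih (fun i hi => hpos i (by simp [hi])) m hm.1).trans (by gcongr)
      _ ≤ ∑ m ∈ Finset.Icc 1 n, (1 / (m : ℝ)) * (1 + Real.log n) ^ ks.length := by
          refine Finset.sum_le_sum_of_subset_of_nonneg ?_ fun m _ _ => by positivity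
          intro m hm
          rw [Finset.mem_Ioo] at hm
          rw [Finset.mem_Icc]
          omega
      _ ≤ (1 + Real.log n) * (1 + Real.log n) ^ ks.length := by
          rw [← Finset.sum_mul]
          gcongr
          exact sum_Icc_inv_le n

/-- A bound for `Aplus n ks - mhsR ks` gives a termwise bound for the indices `k :: ks`. -/
lemma norm_term_sub_le (k : ℕ) (ks : List ℕ) (hpos : ∀ i ∈ ks, 0 < i)
    {C : ℝ} (hC : 0 ≤ C) (h : ∀ n B : ℕ, B ≤ n / 2 →
      ‖Aplus n ks B - (mhsR ks (B + 1) : ℂ)‖ ≤ C * (B / n) * (1 + Real.log n) ^ ks.length) :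
    ∃ E : ℝ, 0 ≤ E ∧ ∀ n m : ℕ, 0 < m → m ≤ n / 2 →
      ‖sineWeight n k m * Aplus n ks (m - 1) - ((1 / (m : ℝ) ^ k * mhsR ks m : ℝ) : ℂ)‖ ≤
        E * (1 + Real.log n) ^ ks.length * ((m / n) / m ^ k) := by
  obtain ⟨D, hD, hw⟩ := norm_sineWeight_sub_le k
  refine ⟨D * (1 + C) + C, by positivity, fun n m hm hmn => ?_⟩
  have hn : 0 < n := by omega
  have hm' : (0 : ℝ) < m := by exact_mod_cast hm
  have hn' : (0 : ℝ) < n := by exact_mod_cast hn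
  have hmn' : (m : ℝ) ≤ n := by exact_mod_cast (by omega : m ≤ n)
  have hlog : 0 ≤ Real.log n := Real.log_natCast_nonneg n
  have hdiff := h n (m - 1) (by omega)
  rw [Nat.sub_add_cancel hm] at hdiff
  set A := Aplus n ks (m - 1)
  set L := (1 + Real.log n) ^ ks.length
  have hL : 0 ≤ L := by positivity
  have hle : ((m - 1 : ℕ) : ℝ) / n ≤ m / n := by gcongr; omega
  have hdiff' : ‖A - (mhsR ks m : ℂ)‖ ≤ C * (m / n) * L := hdiff.trans (by gcongr)
  have hM : mhsR ks m ≤ L := (mhsR_le ks hpos m hm).trans (by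
    have := log_natCast_le hm (by omega : m ≤ n)
    have := Real.log_natCast_nonneg m
    exact pow_le_pow_left₀ (by linarith) (by linarith) _)
  have hA : ‖A‖ ≤ (1 + C) * L := by
    have h1 : ‖A‖ ≤ ‖A - (mhsR ks m : ℂ)‖ + ‖(mhsR ks m : ℂ)‖ := by
      simpa using norm_add_le (A - (mhsR ks m : ℂ)) (mhsR ks m : ℂ)
    rw [Complex.norm_real, Real.norm_eq_abs, abs_of_nonneg (mhsR_nonneg _ _)] at h1
    have h2 : C * (m / n) * L ≤ C * 1 * L := by
      gcongr
      exact (div_le_one hn').2 hmn'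
    linarith
  calc ‖sineWeight n k m * A - ((1 / (m : ℝ) ^ k * mhsR ks m : ℝ) : ℂ)‖
      = ‖(sineWeight n k m - ((1 / (m : ℝ) ^ k : ℝ) : ℂ)) * A +
          ((1 / (m : ℝ) ^ k : ℝ) : ℂ) * (A - (mhsR ks m : ℂ))‖ := by
        rw [Complex.ofReal_mul]; ring_nf
    _ ≤ ‖sineWeight n k m - ((1 / (m : ℝ) ^ k : ℝ) : ℂ)‖ * ‖A‖ +
          1 / (m : ℝ) ^ k * ‖A - (mhsR ks m : ℂ)‖ := by
        refine (norm_add_le _ _).trans ?_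
        rw [norm_mul, norm_mul, Complex.norm_real, Real.norm_eq_abs,
          abs_of_pos (by positivity : 0 < 1 / (m : ℝ) ^ k)]
    _ ≤ (D * (m / n) / m ^ k) * ((1 + C) * L) + 1 / (m : ℝ) ^ k * (C * (m / n) * L) := by
        gcongr
        exact hw n m hm hmn
    _ = _ := by ring

lemma Aplus_cons_sub_mhsR (n k : ℕ) (ks : List ℕ) (B : ℕ) :
    Aplus n (k :: ks) B - (mhsR (k :: ks) (B + 1) : ℂ) = ∑ m ∈ Finset.Icc 1 B,
      (sineWeight n k m * Aplus n ks (m - 1) - ((1 / (m : ℝ) ^ k * mhsR ks m : ℝ) : ℂ)) := by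
  have hI : Finset.Ioo 0 (B + 1) = Finset.Icc 1 B := by
    ext m
    simp only [Finset.mem_Ioo, Finset.mem_Icc]
    omega
  rw [Aplus_cons, mhsR_cons, hI, Complex.ofReal_sum, Finset.sum_sub_distrib]

lemma norm_Aplus_sub_mhsR_le (ks : List ℕ) (hpos : ∀ i ∈ ks, 0 < i) :
    ∃ C : ℝ, 0 ≤ C ∧ ∀ n B : ℕ, B ≤ n / 2 →
      ‖Aplus n ks B - (mhsR ks (B + 1) : ℂ)‖ ≤ C * (B / n) * (1 + Real.log n) ^ ks.length := by
  induction ks with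
  | nil => exact ⟨0, le_rfl, fun n B _ => by simp [Aplus, mhsR]⟩
  | cons k ks ih =>
    have hpos' : ∀ i ∈ ks, 0 < i := fun i hi => hpos i (by simp [hi])
    obtain ⟨C, hC, h⟩ := ih hpos'
    obtain ⟨E, hE, hterm⟩ := norm_term_sub_le k ks hpos' hC h
    refine ⟨E, hE, fun n B hB => ?_⟩
    have hlog : 0 ≤ Real.log n := Real.log_natCast_nonneg n
    rw [Aplus_cons_sub_mhsR, List.length_cons]
    calc _ ≤ ∑ m ∈ Finset.Icc 1 B, E * (1 + Real.log n) ^ ks.length * (1 / n) := by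
          refine norm_sum_le_of_le _ fun m hm => ?_
          rw [Finset.mem_Icc] at hm
          refine (hterm n m hm.1 (hm.2.trans hB)).trans ?_
          have hm' : (0 : ℝ) < m := by exact_mod_cast hm.1
          have hn' : (0 : ℝ) < n := by exact_mod_cast (by omega : 0 < n)
          refine mul_le_mul_of_nonneg_left ?_ (by positivity)
          calc (m / n : ℝ) / m ^ k = m / n * (1 / m ^ k) := by ring
            _ ≤ m / n * (1 / m) :=
                mul_le_mul_of_nonneg_left (one_div_pow_le_one_div hm.1 (hpos k (by simp)))
                  (by positivity)
            _ = 1 / n := by field_simp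
      _ = E * (B / n) * (1 + Real.log n) ^ ks.length := by
          rw [Finset.sum_const, Nat.card_Icc, Nat.add_sub_cancel, nsmul_eq_mul]; ring
      _ ≤ _ := by
          gcongr
          · linarith
          · omega

lemma norm_Aplus_sub_mhsR_le_of_two_le (k : ℕ) (hk : 2 ≤ k) (ks : List ℕ)
    (hpos : ∀ i ∈ ks, 0 < i) : ∃ C : ℝ, 0 ≤ C ∧ ∀ n : ℕ, 2 ≤ n →
      ‖Aplus n (k :: ks) (n / 2) - (mhsR (k :: ks) (n / 2 + 1) : ℂ)‖ ≤
        C * (1 + Real.log n) ^ (ks.length + 1) / n := by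
  obtain ⟨C, hC, h⟩ := norm_Aplus_sub_mhsR_le ks hpos
  obtain ⟨E, hE, hterm⟩ := norm_term_sub_le k ks hpos hC h
  refine ⟨E, hE, fun n hn => ?_⟩
  have hlog : 0 ≤ Real.log n := Real.log_natCast_nonneg n
  rw [Aplus_cons_sub_mhsR]
  calc _ ≤ ∑ m ∈ Finset.Icc 1 (n / 2), E * (1 + Real.log n) ^ ks.length / n * (1 / m) := by
        refine norm_sum_le_of_le _ fun m hm => ?_
        rw [Finset.mem_Icc] at hm
        refine (hterm n m hm.1 hm.2).trans ?_
        have hm' : (1 : ℝ) ≤ m := by exact_mod_cast hm.1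
        calc E * (1 + Real.log n) ^ ks.length * (m / n / m ^ k)
            ≤ E * (1 + Real.log n) ^ ks.length * (m / n / m ^ 2) := by gcongr
          _ = _ := by field_simp
    _ ≤ E * (1 + Real.log n) ^ ks.length / n * (1 + Real.log n) := by
        rw [← Finset.mul_sum]
        gcongr
        exact (sum_Icc_inv_le _).trans (by
          have := log_natCast_le (by omega : 0 < n / 2) (Nat.div_le_self n 2)
          linarith)
    _ = _ := by ring

lemma one_add_log_pow_le (J : ℕ) : ∃ C : ℝ, 0 ≤ C ∧ ∀ y : ℝ, 1 ≤ y →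
    (1 + Real.log y) ^ J ≤ C * √y := by
  refine ⟨(1 + 2 * (J + 1)) ^ J, by positivity, fun y hy => ?_⟩
  set ε : ℝ := 1 / (2 * (J + 1)) with hε
  have hε0 : 0 < ε := by positivity
  have hlog : 0 ≤ Real.log y := Real.log_nonneg hy
  have h1 : 1 ≤ y ^ ε := Real.one_le_rpow hy hε0.le
  have h2 : Real.log y ≤ 2 * (J + 1) * y ^ ε := by
    refine (Real.log_le_rpow_div (by linarith) hε0).trans_eq ?_
    rw [hε]; field_simp
  calc (1 + Real.log y) ^ J ≤ ((1 + 2 * (J + 1)) * y ^ ε) ^ J := by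
        gcongr
        linarith
    _ = (1 + 2 * (J + 1)) ^ J * y ^ (ε * J) := by
        rw [mul_pow, ← Real.rpow_mul_natCast (by linarith)]
    _ ≤ (1 + 2 * (J + 1)) ^ J * √y := by
        rw [Real.sqrt_eq_rpow]
        gcongr ?_ * ?_
        refine Real.rpow_le_rpow_of_exponent_le hy ?_
        rw [hε, div_mul_eq_mul_div, div_le_div_iff₀ (by positivity) two_pos]; linarith

lemma inv_mul_sqrt_le (m : ℕ) (hm : 0 < m) :
    1 / ((m : ℝ) * √m) ≤ 8 * (1 / √(m : ℝ) - 1 / √((m + 1 : ℕ) : ℝ)) := by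
  have hm' : (1 : ℝ) ≤ m := by exact_mod_cast hm
  push_cast
  set a := √(m : ℝ)
  set b := √((m : ℝ) + 1)
  have ha : 0 < a := Real.sqrt_pos.2 (by linarith)
  have hb : 0 < b := Real.sqrt_pos.2 (by linarith)
  have ha2 : a ^ 2 = m := Real.sq_sqrt (by linarith)
  have hb2 : b ^ 2 = m + 1 := Real.sq_sqrt (by linarith)
  have hab : b ≤ 2 * a := by nlinarith
  have hd : (b - a) * (b + a) = 1 := by nlinarith
  have hle : a ≤ b := by nlinarith
  rw [← ha2, div_sub_div _ _ ha.ne' hb.ne', mul_div_assoc', div_le_div_iff₀ (by positivity)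
    (by positivity)]
  have h3 : 1 ≤ (b - a) * (3 * a) := by nlinarith
  have h4 : b ≤ 8 * (b - a) * a ^ 2 := by nlinarith
  nlinarith

lemma sum_Ico_log_pow_div_sq_le (J : ℕ) : ∃ C : ℝ, 0 ≤ C ∧ ∀ N M : ℕ, 0 < N → N ≤ M →
    ∑ m ∈ Finset.Ico N M, (1 + Real.log m) ^ J / (m : ℝ) ^ 2 ≤ C * (1 + Real.log N) ^ J / N := by
  obtain ⟨C, hC, h⟩ := one_add_log_pow_le J
  refine ⟨8 * C, by positivity, fun N M hN hNM => ?_⟩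
  have hN' : (0 : ℝ) < N := by exact_mod_cast hN
  have hlN : 0 ≤ Real.log N := Real.log_natCast_nonneg N
  set K := C * (1 + Real.log N) ^ J / √(N : ℝ) with hK
  have hK0 : 0 ≤ K := by positivity
  calc ∑ m ∈ Finset.Ico N M, (1 + Real.log m) ^ J / (m : ℝ) ^ 2
      ≤ ∑ m ∈ Finset.Ico N M,
          8 * K * (1 / √(m : ℝ) - 1 / √((m + 1 : ℕ) : ℝ)) := by
        refine Finset.sum_le_sum fun m hm => ?_
        rw [Finset.mem_Ico] at hm
        have hm0 : 0 < m := by omega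
        have hm' : (0 : ℝ) < m := by exact_mod_cast hm0
        have hy : 1 ≤ (m : ℝ) / N := (one_le_div hN').2 (by exact_mod_cast hm.1)
        have hly := Real.log_nonneg hy
        have hlm : 0 ≤ Real.log m := Real.log_natCast_nonneg m
        have hsplit : 1 + Real.log m ≤ (1 + Real.log N) * (1 + Real.log (m / N)) := by
          have := Real.log_div hm'.ne' hN'.ne'
          nlinarith [mul_nonneg hlN hly]
        calc (1 + Real.log m) ^ J / (m : ℝ) ^ 2
            ≤ ((1 + Real.log N) ^ J * (C * √(m / N))) / (m : ℝ) ^ 2 := by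
              gcongr
              refine (pow_le_pow_left₀ (by linarith) hsplit J).trans ?_
              rw [mul_pow]
              gcongr
              exact h _ hy
          _ = K * (1 / (m * √(m : ℝ))) := by
              have hs : √(m : ℝ) * √(m : ℝ) = m := Real.mul_self_sqrt hm'.le
              have hs0 : 0 < √(m : ℝ) := Real.sqrt_pos.2 hm'
              have hsN : 0 < √(N : ℝ) := Real.sqrt_pos.2 hN'
              rw [hK, Real.sqrt_div hm'.le]
              field_simp
              rw [sq, hs]
          _ ≤ K * (8 * (1 / √(m : ℝ) - 1 / √((m + 1 : ℕ) : ℝ))) := by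
              gcongr
              exact inv_mul_sqrt_le m hm0
          _ = _ := by ring
    _ = 8 * K * (1 / √(N : ℝ) - 1 / √(M : ℝ)) := by
        rw [← neg_sub (1 / √(M : ℝ)), ← Finset.sum_Ico_sub (fun m : ℕ => 1 / √(m : ℝ)) hNM,
          ← Finset.sum_neg_distrib, Finset.mul_sum]
        simp only [neg_sub]
    _ ≤ 8 * K * (1 / √(N : ℝ)) := by
        gcongr
        have : 0 ≤ 1 / √(M : ℝ) := by positivity
        linarith
    _ = 8 * C * (1 + Real.log N) ^ J / N := by
        have hs : √(N : ℝ) * √(N : ℝ) = N := Real.mul_self_sqrt hN'.le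
        calc 8 * K * (1 / √(N : ℝ)) = 8 * C * (1 + Real.log N) ^ J / (√(N : ℝ) * √(N : ℝ)) := by
              rw [hK]; ring
          _ = _ := by rw [hs]

lemma mhsR_cons_sub {k : ℕ} {ks : List ℕ} {N M : ℕ} (hN : 0 < N) (hNM : N ≤ M) :
    mhsR (k :: ks) M - mhsR (k :: ks) N =
      ∑ m ∈ Finset.Ico N M, (1 / (m : ℝ) ^ k) * mhsR ks m := by
  have hI : ∀ n, Finset.Ioo 0 n = Finset.Ico 1 n := fun n => by
    ext m
    simp only [Finset.mem_Ioo, Finset.mem_Ico]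
    omega
  rw [mhsR_cons, mhsR_cons, hI, hI, sub_eq_iff_eq_add, add_comm,
    Finset.sum_Ico_consecutive _ hN hNM]

lemma monotone_mhsR_cons (k : ℕ) (ks : List ℕ) : Monotone (mhsR (k :: ks)) := by
  intro N M h
  rw [mhsR_cons, mhsR_cons]
  refine Finset.sum_le_sum_of_subset_of_nonneg ?_ fun m _ _ =>
    mul_nonneg (by positivity) (mhsR_nonneg ks m)
  exact Finset.Ioo_subset_Ioo_right h

lemma mhsR_sub_le (k : ℕ) (hk : 2 ≤ k) (ks : List ℕ) (hpos : ∀ i ∈ ks, 0 < i) :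
    ∃ C : ℝ, 0 ≤ C ∧ ∀ N M : ℕ, 0 < N → N ≤ M →
      mhsR (k :: ks) M - mhsR (k :: ks) N ≤ C * (1 + Real.log N) ^ ks.length / N := by
  obtain ⟨C, hC, h⟩ := sum_Ico_log_pow_div_sq_le ks.length
  refine ⟨C, hC, fun N M hN hNM => ?_⟩
  rw [mhsR_cons_sub hN hNM]
  refine le_trans (Finset.sum_le_sum fun m hm => ?_) (h N M hN hNM)
  rw [Finset.mem_Ico] at hm
  have hm' : (1 : ℝ) ≤ m := by exact_mod_cast (by omega : 1 ≤ m)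
  have hlm : 0 ≤ Real.log m := Real.log_natCast_nonneg m
  calc 1 / (m : ℝ) ^ k * mhsR ks m ≤ 1 / (m : ℝ) ^ 2 * (1 + Real.log m) ^ ks.length :=
        mul_le_mul (one_div_le_one_div_of_le (by positivity) (pow_le_pow_right₀ hm' hk))
          (mhsR_le ks hpos m (by omega)) (mhsR_nonneg _ _) (by positivity)
    _ = _ := by ring

lemma exists_tendsto_mhsR (k : ℕ) (hk : 2 ≤ k) (ks : List ℕ) (hpos : ∀ i ∈ ks, 0 < i) :
    ∃ z : ℝ, Tendsto (mhsR (k :: ks)) atTop (nhds z) ∧ ∃ C : ℝ, 0 ≤ C ∧ ∀ N : ℕ, 0 < N →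
      |mhsR (k :: ks) N - z| ≤ C * (1 + Real.log N) ^ ks.length / N := by
  obtain ⟨C, hC, h⟩ := mhsR_sub_le k hk ks hpos
  have hmono := monotone_mhsR_cons k ks
  have hbdd : BddAbove (Set.range (mhsR (k :: ks))) := by
    refine ⟨mhsR (k :: ks) 1 + C, ?_⟩
    rintro _ ⟨M, rfl⟩
    have h1 := h 1 (M + 1) one_pos (by omega)
    have h2 := hmono (Nat.le_succ M)
    simp only [Nat.cast_one, Real.log_one, add_zero, one_pow, mul_one, div_one] at h1
    simp only [Nat.succ_eq_add_one] at h2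
    linarith
  have hz := tendsto_atTop_ciSup hmono hbdd
  refine ⟨_, hz, C, hC, fun N hN => ?_⟩
  rw [abs_sub_comm, abs_of_nonneg (sub_nonneg.2 (hmono.ge_of_tendsto hz N))]
  refine le_of_tendsto (hz.sub_const _) ?_
  filter_upwards [eventually_ge_atTop N] with M hM using h N M hN hM

/-- For an admissible index `k` (i.e. `k_1 ≥ 2`), the multiple zeta value
`ζ(k) = ∑_{m_1 > ⋯ > m_r > 0} ∏_j m_j^{-k_j}` converges, and there are `C > 0` and a
positive integer `J` with `|A_n^+(k) - ζ(k)| ≤ C (log n)^J / n` for all `n ≥ 2`. -/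
theorem stmt_6 (k : List ℕ) (hne : k ≠ []) (hadm : 2 ≤ k.headI) (hpos : ∀ i ∈ k, 0 < i) :
    ∃ z : ℝ, Tendsto (fun n : ℕ => mhsR k n) atTop (nhds z) ∧
      ∃ C : ℝ, 0 < C ∧ ∃ J : ℕ, 0 < J ∧ ∀ n : ℕ, 2 ≤ n →
        ‖Aplus n k (n / 2) - (z : ℂ)‖ ≤ C * Real.log n ^ J / n := by
  obtain ⟨k, ks, rfl⟩ := List.exists_cons_of_ne_nil hne
  have hk : 2 ≤ k := hadm
  have hpos' : ∀ i ∈ ks, 0 < i := fun i hi => hpos i (by simp [hi])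
  obtain ⟨z, hz, D, hD, htail⟩ := exists_tendsto_mhsR k hk ks hpos'
  obtain ⟨C, hC, hA⟩ := norm_Aplus_sub_mhsR_le_of_two_le k hk ks hpos'
  refine ⟨z, hz, (C + 2 * D + 1) * 3 ^ (ks.length + 1), by positivity, ks.length + 1,
    Nat.succ_pos _, fun n hn => ?_⟩
  have hn' : (0 : ℝ) < n := by exact_mod_cast (by omega : 0 < n)
  have hlog : 0 ≤ Real.log n := Real.log_natCast_nonneg n
  have h3 : 1 + Real.log n ≤ 3 * Real.log n := by
    have := log_natCast_le two_pos hn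
    have := Real.log_two_gt_d9
    push_cast at *
    linarith
  have ht := htail (n / 2 + 1) (Nat.succ_pos _)
  have htail' : ‖(mhsR (k :: ks) (n / 2 + 1) : ℂ) - z‖ ≤
      2 * D * (1 + Real.log n) ^ (ks.length + 1) / n := by
    rw [← Complex.ofReal_sub, Complex.norm_real, Real.norm_eq_abs]
    refine ht.trans ?_
    have hl := log_natCast_le (Nat.succ_pos (n / 2)) (by omega : n / 2 + 1 ≤ n)
    have hl0 := Real.log_natCast_nonneg (n / 2 + 1)
    have hhalf : (n : ℝ) / 2 ≤ ((n / 2 + 1 : ℕ) : ℝ) := by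
      rw [div_le_iff₀ two_pos]
      exact_mod_cast (by omega : n ≤ (n / 2 + 1) * 2)
    calc D * (1 + Real.log (n / 2 + 1 : ℕ)) ^ ks.length / (n / 2 + 1 : ℕ)
        ≤ D * (1 + Real.log n) ^ ks.length / (n / 2) := by gcongr
      _ ≤ D * (1 + Real.log n) ^ (ks.length + 1) / (n / 2) := by
          gcongr
          · linarith
          · omega
      _ = _ := by field_simp
  calc ‖Aplus n (k :: ks) (n / 2) - (z : ℂ)‖
      ≤ ‖Aplus n (k :: ks) (n / 2) - (mhsR (k :: ks) (n / 2 + 1) : ℂ)‖ +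
          ‖(mhsR (k :: ks) (n / 2 + 1) : ℂ) - z‖ := norm_sub_le_norm_sub_add_norm_sub _ _ _
    _ ≤ C * (1 + Real.log n) ^ (ks.length + 1) / n +
          2 * D * (1 + Real.log n) ^ (ks.length + 1) / n := add_le_add (hA n hn) htail'
    _ = (C + 2 * D) * (1 + Real.log n) ^ (ks.length + 1) / n := by ring
    _ ≤ (C + 2 * D + 1) * (3 * Real.log n) ^ (ks.length + 1) / n := by
        gcongr (?_ * ?_) / _
        · linarith
        · exact pow_le_pow_left₀ (by linarith) h3 _
    _ = _ := by rw [mul_pow]; ring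
end

section
/- There exists a constant C > 0 such that for all sufficiently large integers n, |A_n^+(1) − (log(n/π) + γ − πi/2)| ≤ C/n, where γ is the Euler–Mascheroni constant. In other words, A_n^+(1) = log(n/π) + γ − πi/2 + O(1/n) as n → ∞. -/
/-- The difference `cot x - 1 / x`, with the cotangent written as a quotient. -/
noncomputable def cotSubInv (x : ℝ) : ℝ := Real.cos x / Real.sin x - 1 / x

/-- The antiderivative `log (sin x) - log x` of `cot x - 1 / x` on `(0, π)`. -/
noncomputable def logSinSubLog (x : ℝ) : ℝ := Real.log (Real.sin x) - Real.log x

theorem hasDerivAt_logSinSubLog {x : ℝ} (h0 : 0 < x) (hπ : x < Real.pi) :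
    HasDerivAt logSinSubLog (cotSubInv x) x := by
  have hs := Real.sin_pos_of_pos_of_lt_pi h0 hπ
  have h := ((Real.hasDerivAt_sin x).log hs.ne').sub (Real.hasDerivAt_log h0.ne')
  rw [← one_div] at h
  exact h

theorem hasDerivAt_cotSubInv {x : ℝ} (h0 : 0 < x) (hπ : x < Real.pi) :
    HasDerivAt cotSubInv (1 / x ^ 2 - 1 / Real.sin x ^ 2) x := by
  have hs := Real.sin_pos_of_pos_of_lt_pi h0 hπ
  have h := ((Real.hasDerivAt_cos x).div (Real.hasDerivAt_sin x) hs.ne').sub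
    ((hasDerivAt_const x (1 : ℝ)).div (hasDerivAt_id x) h0.ne')
  refine h.congr_deriv ?_
  have := Real.sin_sq_add_cos_sq x
  have e : -Real.sin x * Real.sin x - Real.cos x * Real.cos x = -1 := by linarith
  rw [e]
  simp only [id]
  ring

theorem antitoneOn_cotSubInv : AntitoneOn cotSubInv (Set.Ioo 0 Real.pi) := by
  refine antitoneOn_of_deriv_nonpos (convex_Ioo _ _)
    (fun x hx => (hasDerivAt_cotSubInv hx.1 hx.2).continuousAt.continuousWithinAt) ?_ ?_
  · rw [interior_Ioo]
    exact fun x hx => (hasDerivAt_cotSubInv hx.1 hx.2).differentiableAt.differentiableWithinAt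
  · rw [interior_Ioo]
    intro x hx
    rw [(hasDerivAt_cotSubInv hx.1 hx.2).deriv]
    have hs := Real.sin_pos_of_pos_of_lt_pi hx.1 hx.2
    have hle := (Real.sin_lt hx.1).le
    have : 1 / x ^ 2 ≤ 1 / Real.sin x ^ 2 := by gcongr
    linarith

theorem logSinSubLog_sub_mem_Icc {a b : ℝ} (ha : 0 < a) (hab : a ≤ b) (hb : b < Real.pi) :
    logSinSubLog b - logSinSubLog a ∈
      Set.Icc ((b - a) * cotSubInv b) ((b - a) * cotSubInv a) := by
  rcases hab.eq_or_lt with rfl | hlt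
  · simp
  obtain ⟨c, hc, hcs⟩ := exists_hasDerivAt_eq_slope logSinSubLog cotSubInv hlt
    (fun x hx => (hasDerivAt_logSinSubLog (ha.trans_le hx.1)
      (hx.2.trans_lt hb)).continuousAt.continuousWithinAt)
    (fun x hx => hasDerivAt_logSinSubLog (ha.trans hx.1) (hx.2.trans hb))
  have hba : 0 < b - a := sub_pos.2 hlt
  rw [eq_div_iff hba.ne'] at hcs
  rw [← hcs, mul_comm (cotSubInv c)]
  have hcm : c ∈ Set.Ioo 0 Real.pi := ⟨ha.trans hc.1, hc.2.trans hb⟩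
  exact ⟨mul_le_mul_of_nonneg_left
      (antitoneOn_cotSubInv hcm ⟨ha.trans hlt, hb⟩ hc.2.le) hba.le,
    mul_le_mul_of_nonneg_left
      (antitoneOn_cotSubInv ⟨ha, hlt.trans hb⟩ hcm hc.1.le) hba.le⟩

theorem cotSubInv_nonpos {x : ℝ} (h0 : 0 < x) (hπ : x < Real.pi / 2) : cotSubInv x ≤ 0 := by
  have hs := Real.sin_pos_of_pos_of_lt_pi h0 (by linarith)
  have hc := Real.cos_pos_of_mem_Ioo ⟨by linarith, hπ⟩
  have ht := Real.lt_tan h0 hπ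
  rw [Real.tan_eq_sin_div_cos, lt_div_iff₀ hc] at ht
  rw [cotSubInv, sub_nonpos, div_le_div_iff₀ hs h0]
  linarith

theorem logSinSubLog_nonpos {x : ℝ} (h0 : 0 < x) (hπ : x < Real.pi) : logSinSubLog x ≤ 0 :=
  sub_nonpos.2 (Real.log_le_log (Real.sin_pos_of_pos_of_lt_pi h0 hπ) (Real.sin_lt h0).le)

theorem neg_le_logSinSubLog {x : ℝ} (h0 : 0 < x) (h1 : x ≤ 1) : -x ≤ logSinSubLog x := by
  have hcube := Real.sin_gt_sub_cube h0
  have hs : 0 < Real.sin x := Real.sin_pos_of_pos_of_le_one h0 h1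
  have hlog := Real.log_le_sub_one_of_pos (div_pos h0 hs)
  rw [Real.log_div h0.ne' hs.ne'] at hlog
  have : x / Real.sin x ≤ 1 + x := by
    rw [div_le_iff₀ hs]
    nlinarith [pow_pos h0 2, mul_nonneg (pow_pos h0 2).le (sub_nonneg.2 h1),
      mul_nonneg (pow_pos h0 3).le (sub_nonneg.2 h1)]
  unfold logSinSubLog
  linarith

theorem logSinSubLog_pi_div_two : logSinSubLog (Real.pi / 2) = -Real.log (Real.pi / 2) := by
  simp [logSinSubLog]

theorem neg_two_le_cotSubInv {x : ℝ} (h0 : 0 < x) (hx : x ≤ 3 * Real.pi / 4) :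
    -2 ≤ cotSubInv x := by
  have hπ := Real.pi_gt_three
  refine le_trans ?_ (antitoneOn_cotSubInv ⟨h0, by linarith⟩
    ⟨by positivity, by linarith⟩ hx)
  have e : 3 * Real.pi / 4 = Real.pi - Real.pi / 4 := by ring
  have hi : 1 / (3 * Real.pi / 4) ≤ 1 := by
    rw [div_le_one (by positivity)]
    linarith
  have hq : Real.cos (3 * Real.pi / 4) / Real.sin (3 * Real.pi / 4) = -1 := by
    rw [e, Real.cos_pi_sub, Real.sin_pi_sub, Real.cos_pi_div_four, Real.sin_pi_div_four, neg_div,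
      div_self (by positivity)]
  rw [cotSubInv, hq]
  linarith

theorem sum_cotSubInv_le {h : ℝ} (h0 : 0 < h) (h1 : h < Real.pi / 2) (M : ℕ)
    (hM : (M + 1 : ℝ) * h < Real.pi) :
    ∑ m ∈ Finset.Icc 1 (M + 1), h * cotSubInv (m * h) ≤
      logSinSubLog ((M + 1 : ℝ) * h) - logSinSubLog h := by
  induction M with
  | zero => simpa using mul_nonpos_of_nonneg_of_nonpos h0.le (cotSubInv_nonpos h0 h1)
  | succ M ih =>
    push_cast at hM ⊢
    rw [Finset.sum_Icc_succ_top (by omega)]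
    have := ih (by nlinarith)
    have key := (logSinSubLog_sub_mem_Icc (a := (M + 1 : ℝ) * h) (b := (M + 1 + 1 : ℝ) * h)
      (by positivity) (by nlinarith) hM).1
    have e : (M + 1 + 1 : ℝ) * h - (M + 1 : ℝ) * h = h := by ring
    rw [e] at key
    push_cast
    linarith

theorem le_sum_cotSubInv {h : ℝ} (h0 : 0 < h) (M : ℕ) (hM : (M + 1 : ℝ) * h < Real.pi) :
    logSinSubLog ((M + 1 : ℝ) * h) - logSinSubLog h ≤
      ∑ m ∈ Finset.Icc 1 M, h * cotSubInv (m * h) := by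
  induction M with
  | zero => simp
  | succ M ih =>
    push_cast at hM ⊢
    rw [Finset.sum_Icc_succ_top (by omega)]
    have := ih (by nlinarith)
    have key := (logSinSubLog_sub_mem_Icc (a := (M + 1 : ℝ) * h) (b := (M + 1 + 1 : ℝ) * h)
      (by positivity) (by nlinarith) hM).2
    have e : (M + 1 + 1 : ℝ) * h - (M + 1 : ℝ) * h = h := by ring
    rw [e] at key
    push_cast
    linarith

/-- The Riemann sum of `cot x - 1 / x` over `(0, π / 2]` with step `π / n` is `-log (π / 2)` up to
`O(1 / n)`. -/
theorem abs_sum_cotSubInv_add_log_le {n : ℕ} (hn : 4 ≤ n) :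
    |∑ m ∈ Finset.Icc 1 (n / 2), Real.pi / n * cotSubInv (m * (Real.pi / n)) +
      Real.log (Real.pi / 2)| ≤ 2 * (Real.pi / n) := by
  have hn4 : (4 : ℝ) ≤ n := by exact_mod_cast hn
  have hπ := Real.pi_pos
  have hπ4 := Real.pi_le_four
  have hπ3 := Real.pi_gt_three
  set h : ℝ := Real.pi / n with hh
  have h0 : 0 < h := by positivity
  have hnh : n * h = Real.pi := by rw [hh]; field_simp
  have h4 : h ≤ Real.pi / 4 := by nlinarith
  obtain ⟨M, hM⟩ : ∃ M, n / 2 = M + 1 := ⟨n / 2 - 1, by omega⟩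
  have hl : (2 * (M + 1) : ℝ) ≤ n := by exact_mod_cast (by omega : 2 * (M + 1) ≤ n)
  have hu : (n : ℝ) ≤ 2 * (M + 1) + 1 := by exact_mod_cast (by omega : n ≤ 2 * (M + 1) + 1)
  have hl' : (M + 1 : ℝ) * h ≤ Real.pi / 2 := by nlinarith
  have hu' : Real.pi / 2 - h / 2 ≤ (M + 1 : ℝ) * h := by nlinarith
  have e : (M + 1 + 1 : ℝ) * h = (M + 1 : ℝ) * h + h := by ring
  have upper := sum_cotSubInv_le h0 (by linarith) M (by linarith)
  have lower := le_sum_cotSubInv h0 (M + 1) (by push_cast; linarith)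
  push_cast at lower
  have hF := neg_le_logSinSubLog h0 (by linarith)
  have hF' := logSinSubLog_nonpos h0 (by linarith)
  have end_le := (logSinSubLog_sub_mem_Icc (by positivity) hl' (by linarith)).1
  have end_ge := (logSinSubLog_sub_mem_Icc (a := Real.pi / 2) (b := (M + 1 + 1 : ℝ) * h)
    (by positivity) (by linarith) (by linarith)).1
  have b1 := neg_two_le_cotSubInv (x := Real.pi / 2) (by positivity) (by linarith)
  have b2 := neg_two_le_cotSubInv (x := (M + 1 + 1 : ℝ) * h) (by positivity) (by linarith)
  rw [logSinSubLog_pi_div_two] at end_le end_ge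
  rw [hM, abs_le]
  constructor
  · have : -2 * h ≤ ((M + 1 + 1 : ℝ) * h - Real.pi / 2) * cotSubInv ((M + 1 + 1 : ℝ) * h) := by
      nlinarith
    linarith
  · have : -h ≤ (Real.pi / 2 - (M + 1 : ℝ) * h) * cotSubInv (Real.pi / 2) := by
      nlinarith
    linarith

theorem abs_harmonic_half_sub_le {n : ℕ} (hn : 4 ≤ n) :
    |(harmonic (n / 2) : ℝ) - (Real.log (n / 2) + Real.eulerMascheroniConstant)| ≤ 2 / n := by
  have hn4 : (4 : ℝ) ≤ n := by exact_mod_cast hn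
  set M : ℕ := n / 2 with hM
  have hl : (2 * M : ℝ) ≤ n := by exact_mod_cast (by omega : 2 * M ≤ n)
  have hu : (n : ℝ) ≤ 2 * M + 1 := by exact_mod_cast (by omega : n ≤ 2 * M + 1)
  have hM0 : (0 : ℝ) < M := by linarith
  have lo := Real.eulerMascheroniSeq_lt_eulerMascheroniConstant M
  have hi := Real.eulerMascheroniConstant_lt_eulerMascheroniSeq' M
  rw [Real.eulerMascheroniSeq] at lo
  rw [Real.eulerMascheroniSeq', if_neg (by omega)] at hi
  have l1 := Real.log_le_sub_one_of_pos (x := (n / 2 : ℝ) / M) (by positivity)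
  have l2 := Real.log_le_sub_one_of_pos (x := (M + 1 : ℝ) / (n / 2)) (by positivity)
  rw [Real.log_div (by positivity) (by positivity)] at l1 l2
  have r1 : (n / 2 : ℝ) / M ≤ 1 + 2 / n := by
    rw [div_le_iff₀ hM0, ← sub_nonneg]
    have : (1 + 2 / n) * (M : ℝ) - n / 2 = (n * (2 * M - n) + 4 * M) / (2 * n) := by
      field_simp
      ring
    rw [this]
    apply div_nonneg _ (by positivity)
    nlinarith
  have r2 : (M + 1 : ℝ) / (n / 2) ≤ 1 + 2 / n := by
    rw [div_le_iff₀ (by positivity)]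
    have : (1 + 2 / n) * (n / 2 : ℝ) = n / 2 + 1 := by field_simp
    linarith
  rw [abs_le]
  constructor <;> linarith

theorem Aplus_singleton_one {n : ℕ} (hn : 4 ≤ n) :
    Aplus n [1] (n / 2) =
      ((harmonic (n / 2) +
        ∑ m ∈ Finset.Icc 1 (n / 2), Real.pi / n * cotSubInv (m * (Real.pi / n)) : ℝ) : ℂ) -
      (Real.pi / n * (n / 2 : ℕ) : ℝ) * Complex.I := by
  have hn0 : (0 : ℝ) < n := by exact_mod_cast (by omega : 0 < n)
  have hπ := Real.pi_pos
  have hsum : ((n / 2 : ℕ) : ℂ) = ∑ m ∈ Finset.Icc 1 (n / 2), (1 : ℂ) := by simp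
  rw [harmonic_eq_sum_Icc]
  push_cast
  rw [hsum, Finset.mul_sum, Finset.sum_mul, ← Finset.sum_add_distrib, ← Finset.sum_sub_distrib]
  simp only [Aplus]
  refine Finset.sum_congr rfl fun m hm => ?_
  rw [Finset.mem_Icc] at hm
  have hm0 : (0 : ℝ) < m := by exact_mod_cast hm.1
  have hmn : (m : ℝ) < n := by exact_mod_cast (by omega : m < n)
  have hx : Real.pi * m / n = m * (Real.pi / n) := by ring
  have hs : 0 < Real.sin (m * (Real.pi / n)) := by
    apply Real.sin_pos_of_pos_of_lt_pi (by positivity)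
    rw [← hx, div_lt_iff₀ hn0]
    nlinarith
  have hexp : (Real.pi * Complex.I * (((1 : ℕ) : ℂ) - 2) * m / n : ℂ) =
      ((-(m * (Real.pi / n)) : ℝ) : ℂ) * Complex.I := by
    push_cast
    ring
  rw [hexp, Complex.exp_mul_I, ← Complex.ofReal_cos, ← Complex.ofReal_sin, Real.cos_neg,
    Real.sin_neg, hx, cotSubInv]
  have hs' : ((Real.sin (m * (Real.pi / n)) : ℝ) : ℂ) ≠ 0 := by exact_mod_cast hs.ne'
  have hn' : (n : ℂ) ≠ 0 := by exact_mod_cast hn0.ne'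
  have hm' : (m : ℂ) ≠ 0 := by exact_mod_cast hm0.ne'
  have hπ' : (Real.pi : ℂ) ≠ 0 := by exact_mod_cast hπ.ne'
  generalize Real.sin (m * (Real.pi / n)) = s at hs'
  generalize Real.cos (m * (Real.pi / n)) = c
  push_cast
  field_simp
  ring

/-- `A_n^+(1) = log(n/π) + γ - πi/2 + O(1/n)` as `n → ∞`, where `γ` is the
Euler–Mascheroni constant. -/
theorem stmt_7 :
    ∃ C : ℝ, 0 < C ∧ ∃ N : ℕ, ∀ n : ℕ, N ≤ n →
      ‖Aplus n [1] (n / 2) -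
          (((Real.log ((n : ℝ) / Real.pi) + Real.eulerMascheroniConstant : ℝ) : ℂ) -
            Real.pi * Complex.I / 2)‖ ≤ C / n := by
  refine ⟨12, by norm_num, 4, fun n hn => ?_⟩
  have hn0 : (0 : ℝ) < n := by exact_mod_cast (by omega : 0 < n)
  have hπ := Real.pi_pos
  have hπ4 := Real.pi_le_four
  have hH := abs_harmonic_half_sub_le hn
  have hR := abs_sum_cotSubInv_add_log_le hn
  have hlog : Real.log (n / Real.pi) = Real.log (n / 2) - Real.log (Real.pi / 2) := by
    rw [← Real.log_div (by positivity) (by positivity)]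
    congr 1
    field_simp
  have hl : (2 * (n / 2 : ℕ) : ℝ) ≤ n := by exact_mod_cast (by omega : 2 * (n / 2) ≤ n)
  have hu : (n : ℝ) ≤ 2 * (n / 2 : ℕ) + 1 := by exact_mod_cast (by omega : n ≤ 2 * (n / 2) + 1)
  have hI : |Real.pi / 2 - Real.pi / n * (n / 2 : ℕ)| ≤ 2 / n := by
    have e : Real.pi / 2 - Real.pi / n * (n / 2 : ℕ) =
        Real.pi * (n - 2 * (n / 2 : ℕ)) / 2 / n := by
      field_simp
    rw [e, abs_of_nonneg (div_nonneg (by nlinarith) hn0.le)]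
    gcongr
    nlinarith
  rw [Aplus_singleton_one hn, hlog]
  set S := ∑ m ∈ Finset.Icc 1 (n / 2), Real.pi / n * cotSubInv (m * (Real.pi / n))
  set H : ℝ := (harmonic (n / 2) : ℝ)
  set J : ℝ := Real.pi / n * (n / 2 : ℕ)
  have hsplit : (((H + S : ℝ) : ℂ) - (J : ℂ) * Complex.I) -
      (((Real.log (n / 2) - Real.log (Real.pi / 2) + Real.eulerMascheroniConstant : ℝ) : ℂ) -
        Real.pi * Complex.I / 2) =
      ((H - (Real.log (n / 2) + Real.eulerMascheroniConstant) : ℝ) : ℂ) +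
        ((S + Real.log (Real.pi / 2) : ℝ) : ℂ) + ((Real.pi / 2 - J : ℝ) : ℂ) * Complex.I := by
    push_cast
    ring
  rw [hsplit]
  refine (norm_add₃_le).trans ?_
  rw [norm_mul, Complex.norm_I, mul_one, Complex.norm_real, Complex.norm_real, Complex.norm_real]
  simp only [Real.norm_eq_abs]
  have hp : 2 * (Real.pi / n) ≤ 8 / n := by
    rw [← mul_div_assoc]
    gcongr
    linarith
  have e : (12 : ℝ) / n = 2 / n + 8 / n + 2 / n := by ring
  linarith
end

section
/- There exists a constant C > 0 such that for all sufficiently large integers n, |(π/n)·∑_{0 < m ≤ n/2} cos(πm/n)/sin(πm/n) − (log(n/π) + γ)| ≤ C/n, where the sum is over positive integers m with m ≤ n/2 and γ is the Euler–Mascheroni constant. In other words, (π/n)·∑_{0<m≤n/2} cot(πm/n) = log(n/π) + γ + O(1/n) as n → ∞. -/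
open Finset in
/-- Comparison of a right-endpoint Riemann sum of `g`, over the points `h, 2h, …, kh`, with the
increment of a function `G` whose difference quotients are bounded by the endpoint values of `g`. -/
theorem sum_Icc_bounds_of_slope_bounds {g G : ℝ → ℝ} {c h : ℝ} (hh : 0 < h)
    (hG : ∀ a b, 0 < a → a < b → b ≤ c →
      (b - a) * g b ≤ G b - G a ∧ G b - G a ≤ (b - a) * g a)
    {k : ℕ} (hk : 1 ≤ k) (hkc : k * h ≤ c) :
    G (k * h) - G h + h * g (k * h) ≤ ∑ m ∈ Icc 1 k, h * g (m * h) ∧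
      ∑ m ∈ Icc 1 k, h * g (m * h) ≤ G (k * h) - G h + h * g h := by
  induction k, hk using Nat.le_induction with
  | base => simp
  | succ k hk ih =>
    have hk' : (0 : ℝ) < k := by exact_mod_cast hk
    push_cast at hkc ⊢
    have step := hG (k * h) ((k + 1) * h) (by positivity) (by linarith) hkc
    have ih := ih (by linarith)
    rw [show ((k : ℝ) + 1) * h - k * h = h by ring] at step
    rw [sum_Icc_succ_top (by omega)]
    push_cast
    constructor <;> linarith [step.1, step.2, ih.1, ih.2]

namespace Real

theorem sin_pos_of_pos_of_le_pi_div_two {x : ℝ} (hx : 0 < x) (hx' : x ≤ π / 2) : 0 < sin x :=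
  sin_pos_of_pos_of_lt_pi hx (by linarith [pi_pos])

theorem antitoneOn_cot_sub_inv :
    AntitoneOn (fun x : ℝ => cos x / sin x - x⁻¹) (Set.Ioc 0 (π / 2)) := by
  have hd : ∀ x ∈ Set.Ioc (0 : ℝ) (π / 2), HasDerivAt (fun x : ℝ => cos x / sin x - x⁻¹)
      ((-sin x * sin x - cos x * cos x) / sin x ^ 2 - -(x ^ 2)⁻¹) x := fun x hx =>
    ((hasDerivAt_cos x).div (hasDerivAt_sin x)
      (sin_pos_of_pos_of_le_pi_div_two hx.1 hx.2).ne').sub (hasDerivAt_inv hx.1.ne')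
  refine antitoneOn_of_deriv_nonpos (convex_Ioc _ _)
    (fun x hx => (hd x hx).continuousAt.continuousWithinAt) (fun x hx =>
      (hd x (interior_subset hx)).differentiableAt.differentiableWithinAt) fun x hx => ?_
  have hx := interior_subset hx
  have hs := sin_pos_of_pos_of_le_pi_div_two hx.1 hx.2
  rw [(hd x hx).deriv, show -sin x * sin x - cos x * cos x = -1 by
    linarith [sin_sq_add_cos_sq x, sq (sin x), sq (cos x)], neg_div, one_div]
  have : (x ^ 2)⁻¹ ≤ (sin x ^ 2)⁻¹ := by
    gcongr
    exact sin_le hx.1.le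
  linarith

theorem slope_bounds_log_sin_sub_log {a b : ℝ} (ha : 0 < a) (hab : a < b) (hb : b ≤ π / 2) :
    (b - a) * (cos b / sin b - b⁻¹) ≤ (log (sin b) - log b) - (log (sin a) - log a) ∧
      (log (sin b) - log b) - (log (sin a) - log a) ≤ (b - a) * (cos a / sin a - a⁻¹) := by
  have hd : ∀ x ∈ Set.Ioc (0 : ℝ) (π / 2), HasDerivAt (fun x => log (sin x) - log x)
      (cos x / sin x - x⁻¹) x := fun x hx =>
    ((hasDerivAt_sin x).log (sin_pos_of_pos_of_le_pi_div_two hx.1 hx.2).ne').sub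
      (hasDerivAt_log hx.1.ne')
  obtain ⟨c, hc, hslope⟩ := exists_hasDerivAt_eq_slope (fun x => log (sin x) - log x)
    (fun x => cos x / sin x - x⁻¹) hab
    (fun x hx => (hd x ⟨ha.trans_le hx.1, hx.2.trans hb⟩).continuousAt.continuousWithinAt)
    (fun x hx => hd x ⟨ha.trans hx.1, hx.2.le.trans hb⟩)
  have hba : 0 < b - a := sub_pos.2 hab
  have hmem : c ∈ Set.Ioc 0 (π / 2) := ⟨ha.trans hc.1, hc.2.le.trans hb⟩
  rw [eq_div_iff hba.ne', mul_comm] at hslope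
  rw [← hslope]
  exact ⟨mul_le_mul_of_nonneg_left
      (antitoneOn_cot_sub_inv hmem ⟨ha.trans hab, hb⟩ hc.2.le) hba.le,
    mul_le_mul_of_nonneg_left
      (antitoneOn_cot_sub_inv ⟨ha, hab.le.trans hb⟩ hmem hc.1.le) hba.le⟩

theorem cot_sub_inv_nonpos {x : ℝ} (hx : 0 < x) (hx' : x < π / 2) :
    cos x / sin x - x⁻¹ ≤ 0 := by
  have ht := lt_tan hx hx'
  have hc := cos_pos_of_mem_Ioo ⟨by linarith, hx'⟩
  rw [tan_eq_sin_div_cos, lt_div_iff₀ hc] at ht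
  rw [sub_nonpos, ← one_div, div_le_div_iff₀ (sin_pos_of_pos_of_le_pi_div_two hx hx'.le) hx]
  linarith

theorem neg_half_le_log_sin_sub_log {x : ℝ} (hx : 0 < x) (hx' : x ≤ 1) :
    -(x / 2) ≤ log (sin x) - log x := by
  have hs := sin_gt_sub_cube hx
  have hs0 : 0 < sin x := sin_pos_of_pos_of_le_one hx hx'
  rw [← log_div hs0.ne' hx.ne']
  have hlog := one_sub_inv_le_log_of_pos (div_pos hs0 hx)
  rw [inv_div] at hlog
  suffices x / sin x ≤ 1 + x / 2 by linarith
  rw [div_le_iff₀ hs0]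
  nlinarith [mul_pos hx hx, mul_pos (mul_pos hx hx) hx,
    mul_nonneg (mul_pos hx hx).le (sub_nonneg.2 hx')]

/-- `0 ≤ H_k - log k - γ ≤ 1 / k`. -/
theorem harmonic_sub_log_sub_eulerMascheroniConstant_bounds {k : ℕ} (hk : 1 ≤ k) :
    0 ≤ (harmonic k : ℝ) - log k - eulerMascheroniConstant ∧
      (harmonic k : ℝ) - log k - eulerMascheroniConstant ≤ 1 / k := by
  have hk' : (0 : ℝ) < k := by exact_mod_cast hk
  have hlo := eulerMascheroniSeq_lt_eulerMascheroniConstant k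
  have hup := eulerMascheroniConstant_lt_eulerMascheroniSeq' k
  rw [eulerMascheroniSeq'] at hup
  rw [if_neg (by omega)] at hup
  rw [eulerMascheroniSeq] at hlo
  have hlog := log_le_sub_one_of_pos (show (0 : ℝ) < (k + 1) / k by positivity)
  rw [log_div (by positivity) hk'.ne', add_div, div_self hk'.ne'] at hlog
  constructor <;> linarith

end Real

/-- `(π/n)·∑_{0<m≤n/2} cot(πm/n) = log(n/π) + γ + O(1/n)` as `n → ∞`, where `γ` is the
Euler–Mascheroni constant and the sum is over positive integers `m ≤ n/2`
(equivalently `m ≤ ⌊n/2⌋`). -/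
theorem stmt_8 :
    ∃ C : ℝ, 0 < C ∧ ∃ N : ℕ, ∀ n : ℕ, N ≤ n →
      |Real.pi / n *
          ∑ m ∈ Finset.Icc 1 (n / 2),
            Real.cos (Real.pi * m / n) / Real.sin (Real.pi * m / n) -
        (Real.log ((n : ℝ) / Real.pi) + Real.eulerMascheroniConstant)| ≤ C / n := by
  refine ⟨6, by norm_num, 4, fun n hn => ?_⟩
  have hn4 : (4 : ℝ) ≤ n := by exact_mod_cast hn
  have hn0 : (0 : ℝ) < n := by linarith
  have hpi := Real.pi_pos
  obtain ⟨k, hkdef⟩ : ∃ k, k = n / 2 := ⟨_, rfl⟩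
  rw [← hkdef]
  have hk : 1 ≤ k := by omega
  have hk0 : (0 : ℝ) < k := by exact_mod_cast hk
  have hk_up : 2 * (k : ℝ) ≤ n := by exact_mod_cast (by omega : 2 * k ≤ n)
  have hk_lo : (n : ℝ) ≤ 2 * k + 1 := by exact_mod_cast (by omega : n ≤ 2 * k + 1)
  set h : ℝ := Real.pi / n with hdef
  have hh : 0 < h := by positivity
  have hh4 : h ≤ 4 / n := by
    rw [hdef]
    gcongr
    exact Real.pi_le_four
  have hh1 : h ≤ 1 := hh4.trans (by rwa [div_le_one hn0])
  have hkh : k * h ≤ Real.pi / 2 := by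
    rw [hdef, mul_div_assoc', div_le_div_iff₀ hn0 two_pos]
    nlinarith
  have hkh0 : 0 < k * h := by positivity
  have hsum : h * ∑ m ∈ Finset.Icc 1 k, Real.cos (Real.pi * m / n) / Real.sin (Real.pi * m / n) =
      harmonic k + ∑ m ∈ Finset.Icc 1 k,
        h * (Real.cos (m * h) / Real.sin (m * h) - (m * h)⁻¹) := by
    rw [harmonic_eq_sum_Icc, Finset.mul_sum]
    push_cast
    rw [← Finset.sum_add_distrib]
    refine Finset.sum_congr rfl fun m hm => ?_
    have hm0 : (m : ℝ) ≠ 0 := by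
      have := (Finset.mem_Icc.1 hm).1
      positivity
    rw [show Real.pi * m / n = m * h by rw [hdef]; ring, mul_sub, mul_inv,
      mul_left_comm h, mul_inv_cancel₀ hh.ne']
    ring
  have hbounds := sum_Icc_bounds_of_slope_bounds
    (g := fun x => Real.cos x / Real.sin x - x⁻¹) (G := fun x => Real.log (Real.sin x) - Real.log x)
    hh (fun a b => Real.slope_bounds_log_sin_sub_log) hk hkh
  have hlog : Real.log (k * h) = Real.log k - Real.log (n / Real.pi) := by
    rw [← Real.log_div hk0.ne' (by positivity), hdef]
    congr 1
    field_simp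
  have hharm := Real.harmonic_sub_log_sub_eulerMascheroniConstant_bounds hk
  have hinv : 1 / (k : ℝ) ≤ 4 / n := by
    rw [div_le_div_iff₀ hk0 hn0]
    linarith
  have hfirst := Real.neg_half_le_log_sin_sub_log hh hh1
  have hfirst' : Real.log (Real.sin h) ≤ Real.log h :=
    Real.log_le_log (Real.sin_pos_of_pos_of_le_one hh hh1) (Real.sin_le hh.le)
  have hg_first : h * (Real.cos h / Real.sin h - h⁻¹) ≤ 0 :=
    mul_nonpos_of_nonneg_of_nonpos hh.le
      (Real.cot_sub_inv_nonpos hh (by linarith [Real.pi_gt_three]))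
  have hsin := Real.sin_pos_of_pos_of_le_pi_div_two hkh0 hkh
  have hg_last : -(1 / (k : ℝ)) ≤ h * (Real.cos (k * h) / Real.sin (k * h) - (k * h)⁻¹) := by
    have hcos := Real.cos_nonneg_of_mem_Icc ⟨by linarith, hkh⟩
    have : 0 ≤ h * (Real.cos (k * h) / Real.sin (k * h)) := by positivity
    have : h * (k * h)⁻¹ = 1 / (k : ℝ) := by field_simp
    linarith
  have hlast : Real.log (Real.sin (k * h)) ≤ 0 :=
    Real.log_nonpos hsin.le (Real.sin_le_one _)
  have hlast' : -(2 / (n : ℝ)) ≤ Real.log (Real.sin (k * h)) := by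
    have hjordan := Real.mul_le_sin hkh0.le hkh
    rw [show 2 / Real.pi * (k * h) = 2 * k / n by rw [hdef]; field_simp] at hjordan
    have hle := Real.log_le_log (by positivity) hjordan
    have := Real.one_sub_inv_le_log_of_pos (show (0 : ℝ) < 2 * k / n by positivity)
    rw [inv_div] at this
    have : (n : ℝ) / (2 * k) ≤ 1 + 2 / n := by
      rw [div_le_iff₀ (by positivity), add_mul, div_mul_eq_mul_div, one_mul]
      have : 1 ≤ 2 * (2 * (k : ℝ)) / n := by
        rw [one_le_div hn0]
        linarith
      linarith
    linarith
  rw [hsum, abs_le]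
  rw [show (6 : ℝ) / n = 4 / n + 2 / n by ring]
  have : (4 : ℝ) / n = 2 / n + 2 / n := by ring
  constructor <;> linarith [hbounds.1, hbounds.2, hharm.1, hharm.2]
end
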